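/- arXiv:2412.16067 — 11 statements merged into one kernel-verified Lean document; each statement's English description precedes it below -/
import Mathlib

section
/- Let α ∈ (0,1), γ, θ, ν > 0, ρ ∈ (−1,1), ξ ∈ ℂ, T > 0, and let h : [0,T] → ℂ be continuous and satisfy the Volterra equation h(t) = (1/Γ(α)) ∫₀ᵗ (t−s)^{α−1} F(ξ, h(s)) ds for all t ∈ [0,T]. Then the function u(t) := (I^{1−α}h)(t) = (1/Γ(1−α)) ∫₀ᵗ (t−s)^{−α} h(s) ds satisfies u(0) = 0 and u is differentiable at every t ∈ (0,T) with u′(t) = F(ξ, h(t)); that is, h solves the fractional Riccati equation D^α h = F(ξ, h) subject to (I^{1−α}h)(0) = 0. -/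
open MeasureTheory Real

/-- The right-hand side of the rough Heston fractional Riccati equation. -/
noncomputable def riccatiF (γ ν ρ : ℝ) (ξ h : ℂ) : ℂ :=
  -(1 / 2 : ℂ) * (ξ ^ 2 + Complex.I * ξ) + (γ : ℂ) * (Complex.I * ξ * ρ * ν - 1) * h +
    ((γ : ℂ) * ν) ^ 2 / 2 * h ^ 2

/-- The Riemann–Liouville fractional integral `(I^β u)(t) = (1/Γ(β)) ∫₀ᵗ (t-s)^{β-1} u(s) ds`. -/
noncomputable def fracInt (β : ℝ) (u : ℝ → ℂ) (t : ℝ) : ℂ :=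
  ((1 / Real.Gamma β : ℝ) : ℂ) * ∫ s in (0 : ℝ)..t, (((t - s) ^ (β - 1) : ℝ) : ℂ) * u s

/-- The beta integral on `[r, t]`, together with its convergence. -/
lemma integral_rpow_sub_mul_rpow_sub {a b r t : ℝ} (ha : 0 < a) (hb : 0 < b) (hrt : r < t) :
    IntervalIntegrable (fun s : ℝ => (t - s) ^ (a - 1) * (s - r) ^ (b - 1)) volume r t ∧
      ∫ s in r..t, (t - s) ^ (a - 1) * (s - r) ^ (b - 1) =
        Gamma a * Gamma b / Gamma (a + b) * (t - r) ^ (a + b - 1) := by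
  have hc : 0 < t - r := sub_pos.2 hrt
  have hG : 0 < Gamma a * Gamma b / Gamma (a + b) := by
    have := Gamma_pos_of_pos ha
    have := Gamma_pos_of_pos hb
    have := Gamma_pos_of_pos (add_pos ha hb)
    positivity
  have hval : ∫ s in r..t, (t - s) ^ (a - 1) * (s - r) ^ (b - 1) =
      Gamma a * Gamma b / Gamma (a + b) * (t - r) ^ (a + b - 1) := by
    have hbeta : Complex.betaIntegral b a =
        ((Gamma a * Gamma b / Gamma (a + b) : ℝ) : ℂ) := by
      have h0 : Complex.Gamma ((b : ℂ) + a) ≠ 0 :=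
        Complex.Gamma_ne_zero_of_re_pos (by simpa using add_pos hb ha)
      have h1 := Complex.Gamma_mul_Gamma_eq_betaIntegral (s := b) (t := a)
        (by simpa using hb) (by simpa using ha)
      rw [eq_comm, mul_comm, ← eq_div_iff h0] at h1
      rw [h1]
      push_cast [← Complex.Gamma_ofReal]
      rw [add_comm (b : ℂ), mul_comm (Complex.Gamma b)]
    have hscaled := Complex.betaIntegral_scaled b a hc
    have hshift : ∫ s in r..t, (t - s) ^ (a - 1) * (s - r) ^ (b - 1) =
        ∫ x in (0 : ℝ)..(t - r), x ^ (b - 1) * (t - r - x) ^ (a - 1) := by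
      have := intervalIntegral.integral_comp_sub_right (a := r) (b := t)
        (fun x : ℝ => x ^ (b - 1) * (t - r - x) ^ (a - 1)) r
      rw [sub_self] at this
      rw [← this]
      congr 1 with s
      rw [mul_comm]
      ring_nf
    rw [hshift]
    apply Complex.ofReal_injective
    rw [← intervalIntegral.integral_ofReal]
    rw [hbeta] at hscaled
    rw [Complex.ofReal_mul, Complex.ofReal_cpow hc.le, mul_comm]
    convert hscaled using 1
    · refine intervalIntegral.integral_congr fun x hx => ?_
      rw [Set.uIcc_of_le hc.le] at hx
      push_cast [Complex.ofReal_cpow hx.1, Complex.ofReal_cpow (sub_nonneg.2 hx.2)]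
      rfl
    · push_cast
      ring_nf
  refine ⟨?_, hval⟩
  by_contra hni
  rw [intervalIntegral.integral_undef hni] at hval
  exact (mul_pos hG (rpow_pos_of_pos hc _)).ne hval

/-- Fubini's theorem on the triangle `0 < r < s < t` for the Riemann–Liouville kernels. -/
lemma integral_rpow_mul_integral_rpow {a b t : ℝ} (ha : 0 < a) (hb : 0 < b) (ht : 0 ≤ t)
    {g : ℝ → ℂ} (hg : ContinuousOn g (Set.Icc 0 t)) :
    ∫ s in (0 : ℝ)..t, (((t - s) ^ (a - 1) : ℝ) : ℂ) *
        ∫ r in (0 : ℝ)..s, (((s - r) ^ (b - 1) : ℝ) : ℂ) * g r =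
      ((Gamma a * Gamma b / Gamma (a + b) : ℝ) : ℂ) *
        ∫ r in (0 : ℝ)..t, (((t - r) ^ (a + b - 1) : ℝ) : ℂ) * g r := by
  set C : ℝ := Gamma a * Gamma b / Gamma (a + b)
  let μ : Measure ℝ := volume.restrict (Set.Ioo 0 t)
  let K : ℝ → ℝ → ℝ := fun s r =>
    (Set.Ioi r).indicator (fun s => (t - s) ^ (a - 1) * (s - r) ^ (b - 1)) s
  have hK (s r : ℝ) : K s r = (Set.Iio s).indicator
      (fun r => (t - s) ^ (a - 1) * (s - r) ^ (b - 1)) r := by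
    simp [K, Set.indicator_apply]
  have hKmeas : Measurable (fun p : ℝ × ℝ => K p.1 p.2) := by
    have : (fun p : ℝ × ℝ => K p.1 p.2) = {p : ℝ × ℝ | p.2 < p.1}.indicator
        (fun p => (t - p.1) ^ (a - 1) * (p.1 - p.2) ^ (b - 1)) := by
      ext p
      simp [K, Set.indicator_apply]
    rw [this]
    exact Measurable.indicator (by fun_prop) (measurableSet_lt measurable_snd measurable_fst)
  have hKint {r : ℝ} (hr : r ∈ Set.Ioo 0 t) : Integrable (fun s => K s r) μ ∧
      ∫ s, K s r ∂μ = C * (t - r) ^ (a + b - 1) := by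
    have hB := integral_rpow_sub_mul_rpow_sub ha hb hr.2
    have hset : Set.Ioo 0 t ∩ Set.Ioi r = Set.Ioo r t := by
      ext x
      simp only [Set.mem_inter_iff, Set.mem_Ioo, Set.mem_Ioi]
      have := hr.1
      grind
    constructor
    · rw [integrable_indicator_iff measurableSet_Ioi, IntegrableOn,
        Measure.restrict_restrict measurableSet_Ioi, Set.inter_comm, hset]
      exact (intervalIntegrable_iff_integrableOn_Ioo_of_le hr.2.le).1 hB.1
    · rw [← hB.2, setIntegral_indicator measurableSet_Ioi, hset,
        intervalIntegral.integral_of_le hr.2.le, integral_Ioc_eq_integral_Ioo]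
  have hKnonneg {s r : ℝ} (hs : s ∈ Set.Ioo 0 t) : 0 ≤ K s r :=
    Set.indicator_nonneg (s := Set.Iio s) (fun r hr =>
      mul_nonneg (rpow_nonneg (sub_nonneg.2 hs.2.le) _)
        (rpow_nonneg (sub_nonneg.2 (le_of_lt hr)) _)) r |>.trans_eq (hK s r).symm
  have hright : IntervalIntegrable
      (fun r => (((t - r) ^ (a + b - 1) : ℝ) : ℂ) * g r) volume 0 t := by
    refine IntervalIntegrable.mul_continuousOn ?_ (by rwa [Set.uIcc_of_le ht])
    have h := (intervalIntegral.intervalIntegrable_rpow' (a := 0) (b := t)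
      (r := a + b - 1) (by linarith)).comp_sub_left t
    simp only [sub_zero, sub_self] at h
    exact ⟨h.symm.1.ofReal, h.symm.2.ofReal⟩
  have hmeas : AEStronglyMeasurable (fun p : ℝ × ℝ => (K p.1 p.2 : ℂ) * g p.2) (μ.prod μ) := by
    refine AEStronglyMeasurable.mul ?_ ?_
    · exact (Complex.measurable_ofReal.comp hKmeas).aestronglyMeasurable
    · exact ((hg.mono Set.Ioo_subset_Icc_self).aestronglyMeasurable measurableSet_Ioo).comp_snd
  have hintegrable : Integrable (fun p : ℝ × ℝ => (K p.1 p.2 : ℂ) * g p.2) (μ.prod μ) := by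
    rw [integrable_prod_iff' hmeas]
    constructor
    · filter_upwards [ae_restrict_mem measurableSet_Ioo] with r hr
      exact (hKint hr).1.ofReal.mul_const _
    · have h1 := ((intervalIntegrable_iff_integrableOn_Ioo_of_le ht).1 hright).norm.const_mul C
      refine h1.congr ?_
      filter_upwards [ae_restrict_mem measurableSet_Ioo] with r hr
      have h2 : ∫ s, ‖(K s r : ℂ) * g r‖ ∂μ = ∫ s, K s r * ‖g r‖ ∂μ := by
        refine integral_congr_ae ?_
        filter_upwards [ae_restrict_mem measurableSet_Ioo] with s hs
        rw [norm_mul, Complex.norm_real, norm_of_nonneg (hKnonneg hs)]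
      rw [h2, integral_mul_const, (hKint hr).2, norm_mul, Complex.norm_real,
        norm_of_nonneg (rpow_nonneg (sub_nonneg.2 hr.2.le) _), mul_assoc]
  have hswap := integral_integral_swap (f := fun s r => (K s r : ℂ) * g r) hintegrable
  have hleft : ∫ s, ∫ r, (K s r : ℂ) * g r ∂μ ∂μ =
      ∫ s in (0 : ℝ)..t, (((t - s) ^ (a - 1) : ℝ) : ℂ) *
        ∫ r in (0 : ℝ)..s, (((s - r) ^ (b - 1) : ℝ) : ℂ) * g r := by
    rw [intervalIntegral.integral_of_le ht, integral_Ioc_eq_integral_Ioo]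
    refine setIntegral_congr_fun measurableSet_Ioo fun s hs => ?_
    have hset : Set.Ioo 0 t ∩ Set.Iio s = Set.Ioo 0 s := by
      ext x
      simp only [Set.mem_inter_iff, Set.mem_Ioo, Set.mem_Iio]
      have := hs.2
      grind
    have hind (r : ℝ) : (K s r : ℂ) * g r = (Set.Iio s).indicator
        (fun r => (((t - s) ^ (a - 1) : ℝ) : ℂ) * ((((s - r) ^ (b - 1) : ℝ) : ℂ) * g r)) r := by
      rw [hK]
      by_cases hr : r < s <;> simp [hr, mul_assoc]
    simp only [hind]
    rw [setIntegral_indicator measurableSet_Iio, hset, integral_const_mul,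
      intervalIntegral.integral_of_le hs.1.le, integral_Ioc_eq_integral_Ioo]
  rw [← hleft, hswap, ← intervalIntegral.integral_const_mul, intervalIntegral.integral_of_le ht,
    integral_Ioc_eq_integral_Ioo]
  refine setIntegral_congr_fun measurableSet_Ioo fun r hr => ?_
  rw [integral_mul_const, integral_complex_ofReal, (hKint hr).2, Complex.ofReal_mul, mul_assoc]

/-- The semigroup property of Riemann–Liouville fractional integrals. -/
lemma fracInt_fracInt {a b t : ℝ} (ha : 0 < a) (hb : 0 < b) (ht : 0 ≤ t)
    {g : ℝ → ℂ} (hg : ContinuousOn g (Set.Icc 0 t)) :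
    fracInt a (fracInt b g) t = fracInt (a + b) g t := by
  have hGa : (Gamma a : ℂ) ≠ 0 := by exact_mod_cast (Gamma_pos_of_pos ha).ne'
  have hGb : (Gamma b : ℂ) ≠ 0 := by exact_mod_cast (Gamma_pos_of_pos hb).ne'
  simp only [fracInt]
  simp_rw [mul_left_comm _ ((1 / Gamma b : ℝ) : ℂ)]
  rw [intervalIntegral.integral_const_mul, integral_rpow_mul_integral_rpow ha hb ht hg,
    ← mul_assoc, ← mul_assoc]
  congr 1
  push_cast
  field_simp

lemma fracInt_one (u : ℝ → ℂ) (t : ℝ) : fracInt 1 u t = ∫ s in (0 : ℝ)..t, u s := by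
  simp [fracInt]

lemma fracInt_zero_right (β : ℝ) (u : ℝ → ℂ) : fracInt β u 0 = 0 := by
  simp [fracInt]

lemma fracInt_congr {u v : ℝ → ℂ} {t : ℝ} (β : ℝ) (ht : 0 ≤ t)
    (huv : Set.EqOn u v (Set.Icc 0 t)) : fracInt β u t = fracInt β v t := by
  unfold fracInt
  congr 1
  refine intervalIntegral.integral_congr fun s hs => ?_
  rw [Set.uIcc_of_le ht] at hs
  simp only [huv hs]

lemma continuous_riccatiF (γ ν ρ : ℝ) (ξ : ℂ) : Continuous (riccatiF γ ν ρ ξ) := by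
  unfold riccatiF
  fun_prop

theorem stmt4 (α γ θ ν ρ : ℝ) (hα : α ∈ Set.Ioo (0 : ℝ) 1) (hγ : 0 < γ) (hθ : 0 < θ)
    (hν : 0 < ν) (hρ : ρ ∈ Set.Ioo (-1 : ℝ) 1) (ξ : ℂ) (T : ℝ) (hT : 0 < T)
    (h : ℝ → ℂ) (hcont : ContinuousOn h (Set.Icc 0 T))
    (hVolterra : ∀ t ∈ Set.Icc (0 : ℝ) T,
      h t = ((1 / Real.Gamma α : ℝ) : ℂ) *
        ∫ s in (0 : ℝ)..t, (((t - s) ^ (α - 1) : ℝ) : ℂ) * riccatiF γ ν ρ ξ (h s)) :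
    fracInt (1 - α) h 0 = 0 ∧
    ∀ t ∈ Set.Ioo (0 : ℝ) T, HasDerivAt (fracInt (1 - α) h) (riccatiF γ ν ρ ξ (h t)) t := by
  have hg : ContinuousOn (fun s => riccatiF γ ν ρ ξ (h s)) (Set.Icc 0 T) :=
    (continuous_riccatiF γ ν ρ ξ).comp_continuousOn hcont
  refine ⟨fracInt_zero_right _ _, fun t ht => ?_⟩
  have hprim : ∀ x ∈ Set.Icc (0 : ℝ) T,
      fracInt (1 - α) h x = ∫ s in (0 : ℝ)..x, riccatiF γ ν ρ ξ (h s) := by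
    intro x hx
    rw [← fracInt_one, ← sub_add_cancel 1 α, ← fracInt_fracInt (sub_pos.2 hα.2) hα.1 hx.1
      (hg.mono (Set.Icc_subset_Icc_right hx.2)), sub_add_cancel]
    exact fracInt_congr _ hx.1 fun s hs => hVolterra s ⟨hs.1, hs.2.trans hx.2⟩
  have hnhds : Set.Icc (0 : ℝ) T ∈ nhds t := Icc_mem_nhds ht.1 ht.2
  have hderiv : HasDerivAt (fun x => ∫ s in (0 : ℝ)..x, riccatiF γ ν ρ ξ (h s))
      (riccatiF γ ν ρ ξ (h t)) t := by
    refine intervalIntegral.integral_hasDerivAt_right ?_ ?_ (hg.continuousAt hnhds)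
    · refine ContinuousOn.intervalIntegrable (hg.mono ?_)
      rw [Set.uIcc_of_le ht.1.le]
      exact Set.Icc_subset_Icc_right ht.2.le
    · exact ⟨_, hnhds, hg.aestronglyMeasurable measurableSet_Icc⟩
  exact hderiv.congr_of_eventuallyEq (Filter.eventually_of_mem hnhds hprim)
end

section
/- Let S₀, K > 0 and let ξ ∈ ℂ with −1 < Im ξ < 0. Then the function x ↦ e^{−iξx} min(S₀e^x, K) is absolutely integrable on ℝ and ∫_ℝ e^{−iξx} min(S₀e^x, K) dx = K e^{iξ ln(S₀/K)} / (ξ(ξ+i)). -/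
open MeasureTheory Real

theorem stmt8 (S₀ K : ℝ) (hS : 0 < S₀) (hK : 0 < K) (ξ : ℂ)
    (hξ₁ : -1 < ξ.im) (hξ₂ : ξ.im < 0) :
    Integrable (fun x : ℝ =>
      Complex.exp (-(Complex.I * ξ * x)) * ((min (S₀ * Real.exp x) K : ℝ) : ℂ)) ∧
    (∫ x : ℝ, Complex.exp (-(Complex.I * ξ * x)) * ((min (S₀ * Real.exp x) K : ℝ) : ℂ)) =
      (K : ℂ) * Complex.exp (Complex.I * ξ * Real.log (S₀ / K)) / (ξ * (ξ + Complex.I)) := by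
  set f : ℝ → ℂ := fun x =>
    Complex.exp (-(Complex.I * ξ * x)) * ((min (S₀ * Real.exp x) K : ℝ) : ℂ)
  set a : ℂ := -(Complex.I * ξ) with ha
  set c : ℝ := Real.log (K / S₀) with hc
  have hexp : S₀ * Real.exp c = K := by
    rw [hc, Real.exp_log (by positivity)]
    field_simp
  have ha_neg : a.re < 0 := by simpa [ha] using hξ₂
  have ha_pos : 0 < (a + 1).re := by
    have : (a + 1).re = ξ.im + 1 := by simp [ha]
    linarith
  have h_left : Set.EqOn (fun x : ℝ => (S₀ : ℂ) * Complex.exp ((a + 1) * x)) f (Set.Iic c) := by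
    intro x hx
    have hle : S₀ * Real.exp x ≤ K := by
      rw [← hexp]
      exact mul_le_mul_of_nonneg_left (Real.exp_le_exp.2 hx) hS.le
    simp only [f, min_eq_left hle, add_mul, Complex.exp_add, ha, one_mul, neg_mul]
    push_cast
    ring
  have h_right : Set.EqOn (fun x : ℝ => (K : ℂ) * Complex.exp (a * x)) f (Set.Ioi c) := by
    intro x hx
    have hle : K ≤ S₀ * Real.exp x := by
      rw [← hexp]
      exact mul_le_mul_of_nonneg_left (Real.exp_le_exp.2 (le_of_lt hx)) hS.le
    simp only [f, min_eq_right hle, ha, neg_mul]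
    ring
  have hf_left : IntegrableOn f (Set.Iic c) :=
    IntegrableOn.congr_fun ((integrableOn_exp_mul_complex_Iic ha_pos c).const_mul _)
      h_left measurableSet_Iic
  have hf_right : IntegrableOn f (Set.Ioi c) :=
    IntegrableOn.congr_fun ((integrableOn_exp_mul_complex_Ioi ha_neg c).const_mul _)
      h_right measurableSet_Ioi
  refine ⟨by simpa [Set.Iic_union_Ioi] using hf_left.union hf_right, ?_⟩
  have hlog : Real.log (S₀ / K) = -c := by
    rw [hc, ← Real.log_inv, inv_div]
  have hexp' : (S₀ : ℂ) * Complex.exp c = K := by exact_mod_cast hexp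
  have ha0 : a ≠ 0 := fun h => by simp [h] at ha_neg
  have ha1 : a + 1 ≠ 0 := fun h => by simp [h] at ha_pos
  have hden : ξ * (ξ + Complex.I) = -(a * (a + 1)) := by
    linear_combination ξ ^ 2 * Complex.I_sq
  have harg : Complex.I * ξ * ((-c : ℝ) : ℂ) = a * c := by
    push_cast
    ring
  rw [← intervalIntegral.integral_Iic_add_Ioi hf_left hf_right,
    ← setIntegral_congr_fun measurableSet_Iic h_left,
    ← setIntegral_congr_fun measurableSet_Ioi h_right,
    integral_const_mul, integral_const_mul, integral_exp_mul_complex_Iic ha_pos,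
    integral_exp_mul_complex_Ioi ha_neg, hlog, hden, harg, add_mul, one_mul, Complex.exp_add,
    ← hexp']
  field_simp
  ring
end

section
/- Let S₀, K > 0, x ∈ ℝ, and ω₁ < −1. Then (S₀e^x − K)₊ = (1/2π) ∫_ℝ e^{ix(u+iω₁)} · ( −K e^{i(u+iω₁) ln(S₀/K)} / ((u+iω₁)(u+iω₁+i)) ) du, where the integral converges absolutely. -/
open MeasureTheory Real

open scoped FourierTransform

/-- The unit-strike call payoff in log-moneyness `t`, damped by the factor `exp (ω t)`. -/
noncomputable def dampedCall (ω t : ℝ) : ℂ :=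
  ((Real.exp (ω * t) * max (Real.exp t - 1) 0 : ℝ) : ℂ)

/-- The generalized Fourier transform of the unit-strike call payoff along `Im ξ = ω`. -/
noncomputable def callTransform (ω u : ℝ) : ℂ :=
  -1 / ((u + Complex.I * ω) * (u + Complex.I * ω + Complex.I))

lemma continuous_dampedCall (ω : ℝ) : Continuous (dampedCall ω) := by
  unfold dampedCall
  fun_prop

lemma dampedCall_eq_indicator (ω : ℝ) :
    dampedCall ω = (Set.Ioi 0).indicator
      (fun t : ℝ => Complex.exp (((ω + 1 : ℝ) : ℂ) * t) - Complex.exp ((ω : ℂ) * t)) := by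
  ext t
  by_cases ht : 0 < t
  · have h : 1 ≤ Real.exp t := Real.one_le_exp ht.le
    rw [Set.indicator_of_mem (Set.mem_Ioi.2 ht), dampedCall, max_eq_left (by linarith)]
    push_cast
    rw [mul_sub, mul_one, ← Complex.exp_add]
    ring_nf
  · have h : Real.exp t ≤ 1 := Real.exp_le_one_iff.2 (not_lt.1 ht)
    rw [Set.indicator_of_notMem (by simpa using ht), dampedCall, max_eq_right (by linarith)]
    simp

lemma integrable_dampedCall {ω : ℝ} (hω : ω < -1) : Integrable (dampedCall ω) := by
  rw [dampedCall_eq_indicator, integrable_indicator_iff measurableSet_Ioi]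
  refine Integrable.sub (integrableOn_exp_mul_complex_Ioi ?_ 0)
    (integrableOn_exp_mul_complex_Ioi ?_ 0)
  · rw [Complex.ofReal_re]; linarith
  · rw [Complex.ofReal_re]; linarith

lemma add_I_mul_ne_zero {a : ℝ} (ha : a ≠ 0) (u : ℝ) : (u : ℂ) + Complex.I * a ≠ 0 := by
  intro h
  have := congrArg Complex.im h
  simp at this
  exact ha this

lemma add_I_mul_add_I_ne_zero {a : ℝ} (ha : a + 1 ≠ 0) (u : ℝ) :
    (u : ℂ) + Complex.I * a + Complex.I ≠ 0 := by
  intro h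
  have := congrArg Complex.im h
  simp at this
  exact ha this

lemma fourier_dampedCall {ω : ℝ} (hω : ω < -1) (w : ℝ) :
    𝓕 (dampedCall ω) w = callTransform ω (2 * π * w) := by
  have hre (b : ℝ) : ((b : ℂ) - (2 * π * w : ℝ) * Complex.I).re = b := by simp
  have h₁ : ((((ω + 1 : ℝ) : ℂ)) - (2 * π * w : ℝ) * Complex.I).re < 0 := by
    rw [hre]; linarith
  have h₂ : ((ω : ℂ) - (2 * π * w : ℝ) * Complex.I).re < 0 := by
    rw [hre]; linarith
  have key (v : ℝ) : Complex.exp (↑(-2 * π * v * w) * Complex.I) • dampedCall ω v =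
      (Set.Ioi 0).indicator (fun t : ℝ =>
        Complex.exp ((((ω + 1 : ℝ) : ℂ) - (2 * π * w : ℝ) * Complex.I) * t) -
          Complex.exp (((ω : ℂ) - (2 * π * w : ℝ) * Complex.I) * t)) v := by
    rw [dampedCall_eq_indicator]
    by_cases hv : v ∈ Set.Ioi (0 : ℝ)
    · rw [Set.indicator_of_mem hv, Set.indicator_of_mem hv, smul_eq_mul, mul_sub,
        ← Complex.exp_add, ← Complex.exp_add]
      push_cast
      ring_nf
    · rw [Set.indicator_of_notMem hv, Set.indicator_of_notMem hv, smul_zero]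
  rw [Real.fourier_real_eq_integral_exp_smul]
  simp_rw [key]
  rw [integral_indicator measurableSet_Ioi,
    integral_sub (integrableOn_exp_mul_complex_Ioi h₁ 0) (integrableOn_exp_mul_complex_Ioi h₂ 0),
    integral_exp_mul_complex_Ioi h₁, integral_exp_mul_complex_Ioi h₂, callTransform]
  simp only [Complex.ofReal_zero, mul_zero, Complex.exp_zero]
  have e₁ : (((ω + 1 : ℝ) : ℂ)) - (2 * π * w : ℝ) * Complex.I =
      -Complex.I * ((2 * π * w : ℝ) + Complex.I * ω + Complex.I) := by
    push_cast
    linear_combination ((ω : ℂ) + 1) * Complex.I_sq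
  have e₂ : (ω : ℂ) - (2 * π * w : ℝ) * Complex.I =
      -Complex.I * ((2 * π * w : ℝ) + Complex.I * ω) := by
    linear_combination (ω : ℂ) * Complex.I_sq
  rw [e₁, e₂]
  have n₁ := add_I_mul_add_I_ne_zero (a := ω) (by linarith) (2 * π * w)
  have n₂ := add_I_mul_ne_zero (a := ω) (by linarith) (2 * π * w)
  have hI := Complex.I_ne_zero
  generalize (((2 * π * w : ℝ) : ℂ) + Complex.I * ω) = z at n₁ n₂ ⊢
  field_simp
  ring

lemma integrable_callTransform {ω : ℝ} (hω : ω < -1) : Integrable (callTransform ω) := by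
  have hc : 0 < (ω + 1) ^ 2 := by nlinarith
  set m := min 1 ((ω + 1) ^ 2) with hm
  have hm0 : 0 < m := lt_min one_pos hc
  have hcont : Continuous (callTransform ω) := by
    unfold callTransform
    refine Continuous.div (by fun_prop) (by fun_prop) fun u => mul_ne_zero ?_ ?_
    · exact add_I_mul_ne_zero (by linarith) u
    · exact add_I_mul_add_I_ne_zero (by linarith) u
  refine (integrable_inv_one_add_sq.const_mul m⁻¹).mono' hcont.aestronglyMeasurable
    (Filter.Eventually.of_forall fun u => ?_)
  have hs : ‖(u : ℂ) + Complex.I * ω + Complex.I‖ ^ 2 = u ^ 2 + (ω + 1) ^ 2 := by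
    rw [← Complex.normSq_eq_norm_sq, Complex.normSq_apply]
    simp
    ring
  have hz : ‖(u : ℂ) + Complex.I * ω‖ ^ 2 = u ^ 2 + ω ^ 2 := by
    rw [← Complex.normSq_eq_norm_sq, Complex.normSq_apply]
    simp
    ring
  have hle : ‖(u : ℂ) + Complex.I * ω + Complex.I‖ ≤ ‖(u : ℂ) + Complex.I * ω‖ :=
    (sq_le_sq₀ (norm_nonneg _) (norm_nonneg _)).1 (by rw [hs, hz]; nlinarith)
  have hlow : m * (1 + u ^ 2) ≤
      ‖(u : ℂ) + Complex.I * ω‖ * ‖(u : ℂ) + Complex.I * ω + Complex.I‖ :=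
    calc m * (1 + u ^ 2) ≤ u ^ 2 + (ω + 1) ^ 2 := by
          nlinarith [min_le_left 1 ((ω + 1) ^ 2), min_le_right 1 ((ω + 1) ^ 2), sq_nonneg u]
      _ = ‖(u : ℂ) + Complex.I * ω + Complex.I‖ * ‖(u : ℂ) + Complex.I * ω + Complex.I‖ := by
          rw [← hs, sq]
      _ ≤ _ := by gcongr
  rw [callTransform, norm_div, norm_mul, norm_neg, norm_one, one_div, ← mul_inv]
  exact inv_anti₀ (by positivity) hlow

lemma integral_exp_mul_callTransform {ω : ℝ} (hω : ω < -1) (y : ℝ) :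
    ∫ u : ℝ, Complex.exp (Complex.I * u * y) * callTransform ω u =
      ((2 * π : ℝ) : ℂ) * dampedCall ω y := by
  have hπ : (0 : ℝ) < 2 * π := by positivity
  have hF : 𝓕 (dampedCall ω) = fun w => callTransform ω (2 * π * w) :=
    funext (fourier_dampedCall hω)
  have hinv := (continuous_dampedCall ω).fourierInv_fourier_eq (integrable_dampedCall hω)
    (by rw [hF]; exact (integrable_callTransform hω).comp_mul_left' hπ.ne')
  rw [← congrFun hinv y, hF, Real.fourierInv_eq']
  have hint (v : ℝ) : Complex.exp (↑(2 * π * inner ℝ v y) * Complex.I) •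
      callTransform ω (2 * π * v) = (fun u : ℝ =>
        Complex.exp (Complex.I * u * y) * callTransform ω u) (2 * π * v) := by
    have hvy : inner ℝ v y = v * y := by simp [mul_comm]
    rw [hvy, smul_eq_mul]
    push_cast
    ring_nf
  simp_rw [hint]
  rw [Measure.integral_comp_mul_left (fun u : ℝ =>
        Complex.exp (Complex.I * u * y) * callTransform ω u) (2 * π),
    abs_of_pos (inv_pos.2 hπ), Complex.real_smul, ← mul_assoc, ← Complex.ofReal_mul,
    mul_inv_cancel₀ hπ.ne', Complex.ofReal_one, one_mul]

lemma integrable_exp_mul_callTransform {ω : ℝ} (hω : ω < -1) (y : ℝ) :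
    Integrable fun u : ℝ => Complex.exp (Complex.I * u * y) * callTransform ω u := by
  refine (integrable_callTransform hω).bdd_mul (c := 1)
    (Continuous.aestronglyMeasurable (by fun_prop)) (Filter.Eventually.of_forall fun u => ?_)
  rw [Complex.norm_exp]
  simp

theorem stmt9 (S₀ K x ω₁ : ℝ) (hS : 0 < S₀) (hK : 0 < K) (hω : ω₁ < -1) :
    Integrable (fun u : ℝ =>
      Complex.exp (Complex.I * x * (u + Complex.I * ω₁)) *
        (-(K : ℂ) * Complex.exp (Complex.I * (u + Complex.I * ω₁) * Real.log (S₀ / K)) /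
          ((u + Complex.I * ω₁) * (u + Complex.I * ω₁ + Complex.I)))) ∧
    ((max (S₀ * Real.exp x - K) 0 : ℝ) : ℂ) =
      ((1 / (2 * Real.pi) : ℝ) : ℂ) *
        ∫ u : ℝ, Complex.exp (Complex.I * x * (u + Complex.I * ω₁)) *
          (-(K : ℂ) * Complex.exp (Complex.I * (u + Complex.I * ω₁) * Real.log (S₀ / K)) /
            ((u + Complex.I * ω₁) * (u + Complex.I * ω₁ + Complex.I))) := by
  set y := x + Real.log (S₀ / K) with hy
  have hint (u : ℝ) : Complex.exp (Complex.I * x * (u + Complex.I * ω₁)) *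
        (-(K : ℂ) * Complex.exp (Complex.I * (u + Complex.I * ω₁) * Real.log (S₀ / K)) /
          ((u + Complex.I * ω₁) * (u + Complex.I * ω₁ + Complex.I))) =
      ((K * Real.exp (-(ω₁ * y)) : ℝ) : ℂ) *
        (Complex.exp (Complex.I * u * y) * callTransform ω₁ u) := by
    have hexp : Complex.exp (Complex.I * x * (u + Complex.I * ω₁)) *
        Complex.exp (Complex.I * (u + Complex.I * ω₁) * Real.log (S₀ / K)) =
        Complex.exp (-(ω₁ * y)) * Complex.exp (Complex.I * u * y) := by
      rw [← Complex.exp_add, ← Complex.exp_add]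
      congr 1
      rw [hy]
      push_cast
      linear_combination ((x : ℂ) * ω₁ + ω₁ * Real.log (S₀ / K)) * Complex.I_sq
    rw [callTransform]
    push_cast
    linear_combination
      (-(K : ℂ) / ((u + Complex.I * ω₁) * (u + Complex.I * ω₁ + Complex.I))) * hexp
  simp_rw [hint]
  refine ⟨(integrable_exp_mul_callTransform hω y).const_mul _, ?_⟩
  rw [integral_const_mul, integral_exp_mul_callTransform hω, dampedCall]
  norm_cast
  have hey : K * Real.exp y = S₀ * Real.exp x := by
    rw [hy, Real.exp_add, Real.exp_log (div_pos hS hK)]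
    field_simp
  have hmax : max (S₀ * Real.exp x - K) 0 = K * max (Real.exp y - 1) 0 := by
    rw [mul_max_of_nonneg _ _ hK.le, mul_sub, hey, mul_one, mul_zero]
  rw [hmax, Real.exp_neg]
  field_simp
end

section
/- Let X be a real-valued random variable on a probability space, let S₀, K > 0, and let ω₁ < −1 be such that E[e^{−ω₁ X}] < ∞. For ξ ∈ ℂ with Im ξ = ω₁ set Φ(ξ) = E[e^{iξX}]. Then E[(S₀e^X − K)₊] = −(K/2π) ∫_ℝ e^{i(u+iω₁) ln(S₀/K)} Φ(u+iω₁) / ((u+iω₁)(u+iω₁+i)) du, where the integral converges absolutely. -/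
open MeasureTheory Real

lemma integrable_inv_mul_sub_one_verticalLine {σ : ℝ} (hσ : 1 < σ) :
    Integrable fun u : ℝ =>
      (((σ : ℂ) + u * Complex.I) * ((σ : ℂ) + u * Complex.I - 1))⁻¹ := by
  have hne (u : ℝ) : ((σ : ℂ) + u * Complex.I) * ((σ : ℂ) + u * Complex.I - 1) ≠ 0 := by
    refine mul_ne_zero (fun h => ?_) (fun h => ?_) <;>
    · have := congrArg Complex.re h
      simp at this
      linarith
  have hcont : Continuous fun u : ℝ =>
      (((σ : ℂ) + u * Complex.I) * ((σ : ℂ) + u * Complex.I - 1))⁻¹ :=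
    Continuous.inv₀ (by fun_prop) hne
  have hbase : Integrable fun u : ℝ => (σ - 1)⁻¹ ^ 2 * (1 + (u * (σ - 1)⁻¹) ^ 2)⁻¹ :=
    (integrable_inv_one_add_sq.comp_mul_right'
      (inv_ne_zero (sub_pos.2 hσ).ne')).const_mul _
  refine hbase.mono' hcont.aestronglyMeasurable (.of_forall fun u => ?_)
  have hd : 0 < σ - 1 := sub_pos.2 hσ
  have hn1 : ‖(σ : ℂ) + u * Complex.I‖ = √(σ ^ 2 + u ^ 2) := Complex.norm_add_mul_I σ u
  have hn2 : ‖(σ : ℂ) + u * Complex.I - 1‖ = √((σ - 1) ^ 2 + u ^ 2) := by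
    rw [← Complex.norm_add_mul_I]
    congr 1
    push_cast
    ring
  have hle : √((σ - 1) ^ 2 + u ^ 2) ≤ √(σ ^ 2 + u ^ 2) := Real.sqrt_le_sqrt (by nlinarith)
  have hpos : 0 < (σ - 1) ^ 2 + u ^ 2 := by positivity
  have hprod : (σ - 1) ^ 2 + u ^ 2 ≤ √(σ ^ 2 + u ^ 2) * √((σ - 1) ^ 2 + u ^ 2) := by
    calc (σ - 1) ^ 2 + u ^ 2 = √((σ - 1) ^ 2 + u ^ 2) * √((σ - 1) ^ 2 + u ^ 2) :=
          (Real.mul_self_sqrt hpos.le).symm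
      _ ≤ _ := by gcongr
  rw [norm_inv, norm_mul, hn1, hn2]
  calc _ ≤ ((σ - 1) ^ 2 + u ^ 2)⁻¹ := inv_anti₀ hpos hprod
    _ = _ := by field_simp

lemma hasMellin_max_inv_sub_one {s : ℂ} (hs : 1 < s.re) :
    HasMellin (fun t : ℝ => ((max (t⁻¹ - 1) 0 : ℝ) : ℂ)) s (s * (s - 1))⁻¹ := by
  have h1 := hasMellin_cpow_Ioc (-1) (s := s) (by simpa using hs)
  have h2 := hasMellin_one_Ioc (s := s) (by linarith)
  have h := hasMellin_sub h1.1 h2.1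
  rw [h1.2, h2.2] at h
  have hs0 : s ≠ 0 := fun h => by simp [h] at hs; linarith
  have hs1 : s - 1 ≠ 0 := fun h => by
    have := congrArg Complex.re h
    simp at this
    linarith
  have hval : 1 / (s + -1) - 1 / s = (s * (s - 1))⁻¹ := by
    rw [← sub_eq_add_neg]
    field_simp
    ring
  rw [hval] at h
  have heq : Set.EqOn
      (fun t : ℝ => (t : ℂ) ^ (s - 1) • (Set.indicator (Set.Ioc 0 1)
        (fun t : ℝ => (t : ℂ) ^ (-1 : ℂ)) t - Set.indicator (Set.Ioc 0 1) (fun _ => (1 : ℂ)) t))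
      (fun t : ℝ => (t : ℂ) ^ (s - 1) • ((max (t⁻¹ - 1) 0 : ℝ) : ℂ)) (Set.Ioi 0) := by
    intro t (ht : 0 < t)
    dsimp only
    congr 1
    by_cases h1 : t ≤ 1
    · have : 1 ≤ t⁻¹ := (one_le_inv₀ ht).2 h1
      have hmem : t ∈ Set.Ioc (0 : ℝ) 1 := ⟨ht, h1⟩
      rw [Set.indicator_of_mem hmem, Set.indicator_of_mem hmem,
        max_eq_left (by linarith), Complex.cpow_neg_one]
      push_cast
      rfl
    · have : t⁻¹ ≤ 1 := inv_le_one_of_one_le₀ (not_le.1 h1).le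
      rw [Set.indicator_of_notMem (fun h => h1 h.2), Set.indicator_of_notMem (fun h => h1 h.2),
        max_eq_right (by linarith)]
      simp
  refine ⟨h.1.congr_fun heq measurableSet_Ioi, ?_⟩
  rw [← h.2]
  exact (setIntegral_congr_fun measurableSet_Ioi heq).symm

lemma max_exp_sub_one_eq_integral {σ : ℝ} (hσ : 1 < σ) (y : ℝ) :
    ((max (Real.exp y - 1) 0 : ℝ) : ℂ) = ((1 / (2 * π) : ℝ) : ℂ) *
      ∫ u : ℝ, Complex.exp (((σ : ℂ) + u * Complex.I) * y) *
        (((σ : ℂ) + u * Complex.I) * ((σ : ℂ) + u * Complex.I - 1))⁻¹ := by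
  have hm (u : ℝ) := (hasMellin_max_inv_sub_one (s := (σ : ℂ) + u * Complex.I) (by simpa)).2
  have hx : 0 < Real.exp (-y) := Real.exp_pos _
  have key := mellinInv_mellin_eq σ (fun t : ℝ => ((max (t⁻¹ - 1) 0 : ℝ) : ℂ)) hx
    (hasMellin_max_inv_sub_one (s := σ) (by simpa)).1
    (by
      simp only [Complex.VerticalIntegrable, hm]
      exact integrable_inv_mul_sub_one_verticalLine hσ)
    (by
      refine Complex.continuous_ofReal.continuousAt.comp ?_
      exact ((continuousAt_inv₀ hx.ne').sub continuousAt_const).max continuousAt_const)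
  simp only [← Real.exp_neg, neg_neg] at key
  rw [← key, mellinInv]
  simp only [hm, smul_eq_mul, Complex.real_smul]
  congr 1
  refine integral_congr_ae (.of_forall fun u => ?_)
  dsimp only
  rw [Complex.cpow_def_of_ne_zero (by exact_mod_cast hx.ne'), ← Complex.ofReal_log hx.le, Real.log_exp]
  push_cast
  ring_nf

theorem stmt10 {Ω : Type*} [MeasurableSpace Ω] (μ : Measure Ω) [IsProbabilityMeasure μ]
    (X : Ω → ℝ) (hX : Measurable X) (S₀ K ω₁ : ℝ) (hS : 0 < S₀) (hK : 0 < K)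
    (hω : ω₁ < -1)
    (hmom : Integrable (fun a => Real.exp (-ω₁ * X a)) μ) :
    Integrable (fun u : ℝ =>
      Complex.exp (Complex.I * (u + Complex.I * ω₁) * Real.log (S₀ / K)) *
        (∫ a, Complex.exp (Complex.I * (u + Complex.I * ω₁) * X a) ∂μ) /
        ((u + Complex.I * ω₁) * (u + Complex.I * ω₁ + Complex.I))) ∧
    ((∫ a, max (S₀ * Real.exp (X a) - K) 0 ∂μ : ℝ) : ℂ) =
      -((K / (2 * Real.pi) : ℝ) : ℂ) *
        ∫ u : ℝ, Complex.exp (Complex.I * (u + Complex.I * ω₁) * Real.log (S₀ / K)) *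
          (∫ a, Complex.exp (Complex.I * (u + Complex.I * ω₁) * X a) ∂μ) /
          ((u + Complex.I * ω₁) * (u + Complex.I * ω₁ + Complex.I)) := by
  obtain ⟨σ, rfl⟩ : ∃ σ, ω₁ = -σ := ⟨-ω₁, by simp⟩
  have hσ : 1 < σ := by linarith
  rw [neg_neg] at hmom
  set l := Real.log (S₀ / K) with hl
  set F : Ω → ℝ → ℂ := fun a u => Complex.exp (((σ : ℂ) + u * Complex.I) * ((l + X a : ℝ) : ℂ)) *
    (((σ : ℂ) + u * Complex.I) * ((σ : ℂ) + u * Complex.I - 1))⁻¹ with hF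
  have hFint : Integrable (Function.uncurry F) (μ.prod volume) := by
    have hg := (hmom.const_mul (Real.exp (σ * l))).mul_prod
      (integrable_inv_mul_sub_one_verticalLine hσ).norm
    refine hg.mono' ?_ (.of_forall fun p => ?_)
    · have : Measurable (Function.uncurry F) := by
        simp only [hF, Function.uncurry_def]
        fun_prop
      exact this.aestronglyMeasurable
    · simp only [hF, Function.uncurry_def, norm_mul, Complex.norm_exp]
      refine mul_le_mul_of_nonneg_right (le_of_eq ?_) (norm_nonneg _)
      rw [← Real.exp_add]
      congr 1
      simp
      ring
  have hint (u : ℝ) : Complex.exp (Complex.I * (u + Complex.I * (-σ : ℝ)) * l) *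
        (∫ a, Complex.exp (Complex.I * (u + Complex.I * (-σ : ℝ)) * X a) ∂μ) /
        ((u + Complex.I * (-σ : ℝ)) * (u + Complex.I * (-σ : ℝ) + Complex.I)) =
      -∫ a, F a u ∂μ := by
    have hI := Complex.I_mul_I
    have hs : Complex.I * (u + Complex.I * (-σ : ℝ)) = (σ : ℂ) + u * Complex.I := by
      push_cast
      linear_combination (-(σ : ℂ)) * hI
    have hden : (u + Complex.I * (-σ : ℝ)) * (u + Complex.I * (-σ : ℝ) + Complex.I) =
        -(((σ : ℂ) + u * Complex.I) * ((σ : ℂ) + u * Complex.I - 1)) := by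
      rw [← hs]
      linear_combination (u + Complex.I * (-σ : ℝ)) * (u + Complex.I * (-σ : ℝ)) * hI
    rw [hden, hs, div_neg, div_eq_mul_inv, ← integral_const_mul, ← integral_mul_const]
    congr 2
    ext a
    simp only [hF]
    rw [← Complex.exp_add]
    push_cast
    ring_nf
  simp only [hint]
  refine ⟨hFint.integral_prod_right.neg, ?_⟩
  rw [integral_neg, ← integral_integral_swap hFint, ← integral_complex_ofReal, mul_neg, neg_mul,
    neg_neg, ← integral_const_mul]
  refine integral_congr_ae (.of_forall fun a => ?_)
  have hpay : max (S₀ * Real.exp (X a) - K) 0 = K * max (Real.exp (l + X a) - 1) 0 := by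
    rw [mul_max_of_nonneg _ _ hK.le, mul_zero, Real.exp_add, hl, Real.exp_log (div_pos hS hK)]
    congr 1
    field_simp
  dsimp only
  rw [hpay, Complex.ofReal_mul, max_exp_sub_one_eq_integral hσ]
  simp only [hF]
  push_cast
  ring
end

section
/- Let X be a real-valued random variable on a probability space, let S₀, K > 0, and let ω₁ > 0 be such that E[e^{−ω₁ X}] < ∞. For ξ ∈ ℂ with Im ξ = ω₁ set Φ(ξ) = E[e^{iξX}]. Then E[(K − S₀e^X)₊] = −(K/2π) ∫_ℝ e^{i(u+iω₁) ln(S₀/K)} Φ(u+iω₁) / ((u+iω₁)(u+iω₁+i)) du, where the integral converges absolutely. -/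
open MeasureTheory Real

/-- The Mellin transform of the put payoff `x ↦ (1 - x)₊` is `1 / (s (s + 1))` for `0 < Re s`. -/
lemma hasMellin_max_one_sub {s : ℂ} (hs : 0 < s.re) :
    HasMellin (fun x : ℝ => ((max (1 - x) 0 : ℝ) : ℂ)) s (1 / (s * (s + 1))) := by
  have h1 := hasMellin_one_Ioc hs
  have h2 := hasMellin_cpow_Ioc 1 (s := s) (by simp; linarith)
  have h3 := hasMellin_sub h1.1 h2.1
  have hs0 : s ≠ 0 := by rintro rfl; simp at hs
  have hs1 : s + 1 ≠ 0 := by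
    intro h
    have := congrArg Complex.re h
    simp at this
    linarith
  have heq : Set.EqOn (fun t : ℝ => (t : ℂ) ^ (s - 1) •
        (Set.indicator (Set.Ioc 0 1) (fun _ => 1 : ℝ → ℂ) t -
          Set.indicator (Set.Ioc 0 1) (fun t => (t : ℂ) ^ (1 : ℂ) : ℝ → ℂ) t))
      (fun t : ℝ => (t : ℂ) ^ (s - 1) • ((max (1 - t) 0 : ℝ) : ℂ)) (Set.Ioi 0) := by
    intro t ht
    have ht : 0 < t := ht
    by_cases h : t ≤ 1
    · have hm : t ∈ Set.Ioc (0 : ℝ) 1 := ⟨ht, h⟩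
      simp [Set.indicator_of_mem hm, max_eq_left (sub_nonneg.2 h)]
    · have hm : t ∉ Set.Ioc (0 : ℝ) 1 := fun h' => h h'.2
      simp only [Set.indicator_of_notMem hm, max_eq_right (by linarith : 1 - t ≤ 0)]
      simp
  refine ⟨(integrableOn_congr_fun heq measurableSet_Ioi).1 h3.1, ?_⟩
  rw [mellin, ← setIntegral_congr_fun measurableSet_Ioi heq]
  refine h3.2.trans ?_
  rw [h1.2, h2.2]
  field_simp
  ring

lemma integrable_one_div_shifted_mul {ω : ℝ} (hω : 0 < ω) :
    Integrable (fun u : ℝ =>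
      1 / (((u : ℂ) + Complex.I * ω) * (u + Complex.I * ω + Complex.I))) := by
  have hb : Integrable (fun u : ℝ => (ω ^ 2)⁻¹ * (1 + (u / ω) ^ 2)⁻¹) :=
    (integrable_inv_one_add_sq.comp_div hω.ne').const_mul _
  refine hb.mono' (Measurable.aestronglyMeasurable (by fun_prop)) (Filter.Eventually.of_forall fun u => ?_)
  have e1 : ‖(u : ℂ) + Complex.I * ω‖ = √(u ^ 2 + ω ^ 2) := by
    rw [mul_comm, Complex.norm_add_mul_I]
  have e2 : ‖(u : ℂ) + Complex.I * ω + Complex.I‖ = √(u ^ 2 + (ω + 1) ^ 2) := by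
    rw [← Complex.norm_add_mul_I]
    push_cast
    ring_nf
  have h12 : √(u ^ 2 + ω ^ 2) ≤ √(u ^ 2 + (ω + 1) ^ 2) := by
    apply Real.sqrt_le_sqrt
    nlinarith
  have hpos : 0 < u ^ 2 + ω ^ 2 := by positivity
  rw [norm_div, norm_mul, norm_one, e1, e2, ← mul_inv, one_div]
  have h3 : ω ^ 2 * (1 + (u / ω) ^ 2) = u ^ 2 + ω ^ 2 := by
    field_simp
    ring
  rw [h3]
  apply inv_anti₀ hpos
  calc u ^ 2 + ω ^ 2 = √(u ^ 2 + ω ^ 2) * √(u ^ 2 + ω ^ 2) := (Real.mul_self_sqrt hpos.le).symm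
    _ ≤ _ := by gcongr

lemma norm_cexp_I_mul_shifted (u ω y : ℝ) :
    ‖Complex.exp (Complex.I * (u + Complex.I * ω) * y)‖ = Real.exp (-ω * y) := by
  rw [Complex.norm_exp]
  simp

/-- Fourier representation of the normalised put payoff along `Im ξ = ω > 0`. -/
lemma integral_cexp_mul_one_div_shifted {ω : ℝ} (hω : 0 < ω) (y : ℝ) :
    ∫ u : ℝ, Complex.exp (Complex.I * (u + Complex.I * ω) * y) *
      (1 / (((u : ℂ) + Complex.I * ω) * (u + Complex.I * ω + Complex.I))) =
    -(2 * π : ℂ) * ((max (1 - Real.exp y) 0 : ℝ) : ℂ) := by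
  have hM : ∀ u : ℝ, mellin (fun x : ℝ => ((max (1 - x) 0 : ℝ) : ℂ)) (ω + u * Complex.I) =
      -(1 / ((((-u : ℝ) : ℂ) + Complex.I * ω) *
        (((-u : ℝ) : ℂ) + Complex.I * ω + Complex.I))) := by
    intro u
    rw [(hasMellin_max_one_sub (s := ω + u * Complex.I) (by simpa using hω)).2, ← div_neg]
    congr 1
    push_cast
    ring_nf
    simp only [Complex.I_sq]
    ring
  have hV : Complex.VerticalIntegrable
      (mellin (fun x : ℝ => ((max (1 - x) 0 : ℝ) : ℂ))) ω := by
    unfold Complex.VerticalIntegrable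
    simp_rw [hM]
    exact (integrable_one_div_shifted_mul hω).comp_neg.neg
  have h := mellinInv_mellin_eq ω (fun x : ℝ => ((max (1 - x) 0 : ℝ) : ℂ)) (Real.exp_pos y)
    (hasMellin_max_one_sub (s := ω) (by simpa using hω)).1 hV (by fun_prop)
  rw [← h, mellinInv, ← integral_neg_eq_self, Complex.real_smul]
  have hE : ∀ u : ℝ, ((Real.exp y : ℝ) : ℂ) ^ (-((ω : ℂ) + u * Complex.I)) •
      mellin (fun x : ℝ => ((max (1 - x) 0 : ℝ) : ℂ)) (ω + u * Complex.I) =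
      -(Complex.exp (Complex.I * (((-u : ℝ) : ℂ) + Complex.I * ω) * y) *
      (1 / ((((-u : ℝ) : ℂ) + Complex.I * ω) *
        (((-u : ℝ) : ℂ) + Complex.I * ω + Complex.I)))) := by
    intro u
    rw [hM, smul_eq_mul, mul_neg, Complex.cpow_def_of_ne_zero (by simp), ← Complex.ofReal_log
      (Real.exp_pos y).le, Real.log_exp]
    congr 3
    push_cast
    ring_nf
    simp only [Complex.I_sq]
    ring
  simp_rw [hE]
  rw [integral_neg]
  have hpi : (π : ℂ) ≠ 0 := by exact_mod_cast Real.pi_ne_zero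
  have hJ : ∀ J : ℂ, J = -(2 * π : ℂ) * (((1 / (2 * π) : ℝ) : ℂ) * -J) := by
    intro J
    push_cast
    field_simp
  exact hJ _

theorem stmt11 {Ω : Type*} [MeasurableSpace Ω] (μ : Measure Ω) [IsProbabilityMeasure μ]
    (X : Ω → ℝ) (hX : Measurable X) (S₀ K ω₁ : ℝ) (hS : 0 < S₀) (hK : 0 < K)
    (hω : 0 < ω₁)
    (hmom : Integrable (fun a => Real.exp (-ω₁ * X a)) μ) :
    Integrable (fun u : ℝ =>
      Complex.exp (Complex.I * (u + Complex.I * ω₁) * Real.log (S₀ / K)) *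
        (∫ a, Complex.exp (Complex.I * (u + Complex.I * ω₁) * X a) ∂μ) /
        ((u + Complex.I * ω₁) * (u + Complex.I * ω₁ + Complex.I))) ∧
    ((∫ a, max (K - S₀ * Real.exp (X a)) 0 ∂μ : ℝ) : ℂ) =
      -((K / (2 * Real.pi) : ℝ) : ℂ) *
        ∫ u : ℝ, Complex.exp (Complex.I * (u + Complex.I * ω₁) * Real.log (S₀ / K)) *
          (∫ a, Complex.exp (Complex.I * (u + Complex.I * ω₁) * X a) ∂μ) /
          ((u + Complex.I * ω₁) * (u + Complex.I * ω₁ + Complex.I)) := by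
  set L := Real.log (S₀ / K) with hL
  let D : ℝ → ℂ := fun u =>
    1 / (((u : ℂ) + Complex.I * ω₁) * (u + Complex.I * ω₁ + Complex.I))
  have hD : Integrable D := integrable_one_div_shifted_mul hω
  let G : ℝ → Ω → ℂ := fun u a =>
    Complex.exp (Complex.I * (u + Complex.I * ω₁) * ((X a + L : ℝ) : ℂ)) * D u
  have hG : Integrable (Function.uncurry G) (volume.prod μ) := by
    refine ((hD.norm.mul_prod hmom).const_mul (Real.exp (-ω₁ * L))).mono' ?_
      (Filter.Eventually.of_forall fun p => ?_)
    · apply Measurable.aestronglyMeasurable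
      simp only [G, D, Function.uncurry_def]
      fun_prop
    · simp only [G, Function.uncurry_def]
      rw [norm_mul, norm_cexp_I_mul_shifted, mul_add, Real.exp_add]
      apply le_of_eq
      ring
  have hinner : ∀ u : ℝ, Complex.exp (Complex.I * (u + Complex.I * ω₁) * L) *
        (∫ a, Complex.exp (Complex.I * (u + Complex.I * ω₁) * X a) ∂μ) /
        ((u + Complex.I * ω₁) * (u + Complex.I * ω₁ + Complex.I)) = ∫ a, G u a ∂μ := by
    intro u
    simp only [G, D]
    rw [integral_mul_const, mul_one_div, ← integral_const_mul]
    congr 2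
    ext a
    rw [← Complex.exp_add]
    congr 1
    push_cast
    ring
  simp_rw [hinner]
  refine ⟨hG.integral_prod_left, ?_⟩
  rw [integral_integral_swap hG]
  have hpay : ∀ a, max (K - S₀ * Real.exp (X a)) 0 = K * max (1 - Real.exp (X a + L)) 0 := by
    intro a
    rw [mul_max_of_nonneg _ _ hK.le, Real.exp_add, hL, Real.exp_log (div_pos hS hK), mul_zero]
    congr 1
    field_simp
  simp_rw [hpay, G, D, integral_cexp_mul_one_div_shifted hω]
  rw [integral_const_mul, integral_const_mul, integral_complex_ofReal]
  have hpi : (π : ℂ) ≠ 0 := by exact_mod_cast Real.pi_ne_zero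
  push_cast
  field_simp
end

section
/- Let μ₋ < −1 < 0 < μ₊, let S₀, K > 0, and let Φ : ℂ → ℂ be holomorphic and bounded on the open strip {z : μ₋ < Im z < μ₊} with Φ(0) = 1. Then for any ω₁ ∈ (μ₋, −1) and ω₂ ∈ (0, μ₊), ( −(K/2π) ∫_{Im ξ = ω₁} e^{iξ ln(S₀/K)} Φ(ξ) / (ξ(ξ+i)) dξ ) − ( −(K/2π) ∫_{Im ξ = ω₂} e^{iξ ln(S₀/K)} Φ(ξ) / (ξ(ξ+i)) dξ ) = S₀ Φ(−i) − K. Here ∫_{Im ξ = ω} f(ξ) dξ denotes ∫_ℝ f(u+iω) du, and both integrals converge absolutely. -/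
open MeasureTheory Real

/-- The Flat iFT call-pricing integrand `ξ ↦ e^{iξ ln(S₀/K)} Φ(ξ)/(ξ(ξ+i))` evaluated on the
horizontal line `Im ξ = ω`, at the point `ξ = u + iω`. -/
noncomputable def priceIntegrand (Φ : ℂ → ℂ) (S₀ K ω u : ℝ) : ℂ :=
  Complex.exp (Complex.I * (u + Complex.I * ω) * Real.log (S₀ / K)) * Φ (u + Complex.I * ω) /
    ((u + Complex.I * ω) * (u + Complex.I * ω + Complex.I))

open Filter Topology Complex in
/-- If `h` is holomorphic on a neighbourhood of the closed strip `a ≤ Im z ≤ b` and decays there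
like `C / |Re z|`, its symmetric integrals along the two boundary lines agree in the limit. -/
lemma tendsto_integral_strip_sub_zero {h : ℂ → ℂ} {s : Set ℂ} {a b C : ℝ} (hab : a ≤ b)
    (hs : ∀ z : ℂ, z.im ∈ Set.Icc a b → z ∈ s) (hd : DifferentiableOn ℂ h s)
    (hC : ∀ z : ℂ, z.im ∈ Set.Icc a b → 1 ≤ |z.re| → ‖h z‖ ≤ C / |z.re|) :
    Tendsto (fun R : ℝ => (∫ u in (-R)..R, h (u + a * I)) - ∫ u in (-R)..R, h (u + b * I))
      atTop (𝓝 0) := by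
  have side : ∀ R : ℝ, 1 ≤ |R| → ‖∫ y in a..b, h (R + y * I)‖ ≤ C / |R| * |b - a| := by
    intro R hR
    refine intervalIntegral.norm_integral_le_of_norm_le_const fun y hy => ?_
    rw [Set.uIoc_of_le hab] at hy
    simpa using hC (R + y * I) (by simpa using ⟨hy.1.le, hy.2⟩) (by simpa using hR)
  have hlim : Tendsto (fun R : ℝ => 2 * (C / R * |b - a|)) atTop (𝓝 0) := by
    simpa using (((tendsto_const_nhds (x := C)).div_atTop tendsto_id).mul_const
      |b - a|).const_mul 2
  refine squeeze_zero_norm' ?_ hlim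
  filter_upwards [eventually_ge_atTop 1] with R hR1
  have hR : 0 < R := by linarith
  have key := Complex.integral_boundary_rect_eq_zero_of_differentiableOn h (-R + a * I) (R + b * I)
    (hd.mono fun z hz => hs z (by
      rw [mem_reProdIm] at hz
      simpa [Set.uIcc_of_le hab] using hz.2))
  simp only [add_re, neg_re, ofReal_re, mul_re, I_re, mul_zero, ofReal_im, I_im, mul_one, sub_self,
    add_zero, add_im, neg_im, neg_zero, mul_im, zero_add, smul_eq_mul] at key
  have h1 := side R (by rwa [abs_of_pos hR])
  have h2 := side (-R) (by rwa [abs_neg, abs_of_pos hR])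
  rw [abs_neg] at h2
  rw [abs_of_pos hR] at h1 h2
  have e : (∫ u in (-R)..R, h (u + a * I)) - ∫ u in (-R)..R, h (u + b * I)
      = I * (∫ y in a..b, h ((-R : ℝ) + y * I)) - I * ∫ y in a..b, h (R + y * I) := by
    linear_combination key
  rw [e]
  refine (norm_sub_le _ _).trans ?_
  simp only [norm_mul, norm_I, one_mul]
  linarith

open Complex in
lemma ofReal_add_mul_I_ne_zero {w : ℝ} (hw : w ≠ 0) (u : ℝ) : (u : ℂ) + w * I ≠ 0 := fun h =>
  hw (by simpa using congrArg Complex.im h)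

open Complex in
lemma continuous_inv_ofReal_add_mul_I {w : ℝ} (hw : w ≠ 0) :
    Continuous fun u : ℝ => ((u : ℂ) + w * I)⁻¹ :=
  (by fun_prop : Continuous fun u : ℝ => (u : ℂ) + w * I).inv₀ (ofReal_add_mul_I_ne_zero hw)

open Complex in
lemma integral_inv_ofReal_add_mul_I {w : ℝ} (hw : w ≠ 0) (R : ℝ) :
    ∫ u in (-R)..R, ((u : ℂ) + w * I)⁻¹ = -2 * Real.arctan (R / w) * I := by
  have hpos : ∀ u : ℝ, u ^ 2 + w ^ 2 ≠ 0 := fun u => by positivity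
  have hder : ∀ u : ℝ, HasDerivAt
      (fun u : ℝ => ((Real.log (u ^ 2 + w ^ 2) / 2 : ℝ) : ℂ) - (Real.arctan (u / w) : ℝ) * I)
      ((u : ℂ) + w * I)⁻¹ u := by
    intro u
    have h1 := ((((hasDerivAt_id u).pow 2).add_const (w ^ 2)).log (hpos u)).div_const 2
    have h2 := ((hasDerivAt_id u).div_const w).arctan
    have h := h1.ofReal_comp.sub (h2.ofReal_comp.mul_const I)
    refine HasDerivAt.congr_deriv h ?_
    have hz := ofReal_add_mul_I_ne_zero hw u
    have hp : (u : ℂ) ^ 2 + (w : ℂ) ^ 2 ≠ 0 := by exact_mod_cast hpos u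
    have hw' : (w : ℂ) ≠ 0 := by exact_mod_cast hw
    have hq : 1 + ((u : ℂ) / w) ^ 2 = (u ^ 2 + w ^ 2) / w ^ 2 := by field_simp; ring
    simp only [id, Pi.pow_apply]
    push_cast
    rw [hq]
    field_simp
    linear_combination (-w ^ 2 : ℂ) * I_sq
  rw [intervalIntegral.integral_eq_sub_of_hasDerivAt (fun u _ => hder u)
    ((continuous_inv_ofReal_add_mul_I hw).intervalIntegrable _ _)]
  rw [neg_div, Real.arctan_neg, neg_sq]
  push_cast
  ring

open Filter Topology Complex in
lemma tendsto_integral_inv_ofReal_add_mul_I_of_pos {w : ℝ} (hw : 0 < w) :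
    Tendsto (fun R : ℝ => ∫ u in (-R)..R, ((u : ℂ) + w * I)⁻¹) atTop (𝓝 (-Real.pi * I)) := by
  simp_rw [integral_inv_ofReal_add_mul_I hw.ne']
  have h := (Real.tendsto_arctan_atTop.mono_right nhdsWithin_le_nhds).comp
    (tendsto_id.atTop_div_const hw)
  convert ((Complex.continuous_ofReal.tendsto _).comp h).const_mul (-2) |>.mul_const I using 2
  · simp
  · simp
    ring

open Filter Topology Complex in
lemma tendsto_integral_inv_ofReal_add_mul_I_of_neg {w : ℝ} (hw : w < 0) :
    Tendsto (fun R : ℝ => ∫ u in (-R)..R, ((u : ℂ) + w * I)⁻¹) atTop (𝓝 (Real.pi * I)) := by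
  have h := (tendsto_integral_inv_ofReal_add_mul_I_of_pos (neg_pos.mpr hw)).neg
  simp_rw [integral_inv_ofReal_add_mul_I (neg_pos.mpr hw).ne'] at h
  simp_rw [integral_inv_ofReal_add_mul_I hw.ne]
  convert h using 2
  · rw [div_neg, Real.arctan_neg]
    push_cast
    ring
  · ring

lemma integrable_inv_sq_add_sq {w : ℝ} (hw : w ≠ 0) :
    Integrable fun u : ℝ => (u ^ 2 + w ^ 2)⁻¹ := by
  refine ((integrable_inv_one_add_sq.comp_div hw).const_mul (w ^ 2)⁻¹).congr
    (Filter.Eventually.of_forall fun u => ?_)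
  have : u ^ 2 + w ^ 2 ≠ 0 := by positivity
  have hq : 1 + (u / w) ^ 2 = (u ^ 2 + w ^ 2) / w ^ 2 := by field_simp; ring
  simp only [hq]
  field_simp

open Complex in
/-- A bounded continuous function divided by `z (z + i)` is integrable along any horizontal line
avoiding both poles. -/
lemma integrable_div_mul_add_I {f : ℝ → ℂ} {M w : ℝ} (hf : Continuous f) (hM : ∀ u, ‖f u‖ ≤ M)
    (hw : w ≠ 0) (hw1 : w + 1 ≠ 0) :
    Integrable fun u : ℝ => f u / (((u : ℂ) + w * I) * (u + w * I + I)) := by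
  have e : ∀ u : ℝ, (u : ℂ) + w * I + I = u + (w + 1 : ℝ) * I := fun u => by push_cast; ring
  have hsq : ∀ u v : ℝ, ‖((u : ℂ) + v * I)⁻¹‖ ^ 2 = (u ^ 2 + v ^ 2)⁻¹ := fun u v => by
    rw [norm_inv, inv_pow, Complex.sq_norm, normSq_add_mul_I]
  have hM0 : 0 ≤ M := (norm_nonneg _).trans (hM 0)
  simp_rw [e, div_eq_mul_inv, mul_inv]
  refine (((integrable_inv_sq_add_sq hw).add (integrable_inv_sq_add_sq hw1)).const_mul M).mono'
    (hf.mul ((continuous_inv_ofReal_add_mul_I hw).mul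
      (continuous_inv_ofReal_add_mul_I hw1))).aestronglyMeasurable
    (Filter.Eventually.of_forall fun u => ?_)
  rw [norm_mul, norm_mul, Pi.add_apply, ← hsq, ← hsq]
  refine mul_le_mul (hM u) ?_ (by positivity) hM0
  nlinarith [sq_nonneg (‖((u : ℂ) + w * I)⁻¹‖ - ‖((u : ℂ) + (w + 1 : ℝ) * I)⁻¹‖),
    sq_nonneg ‖((u : ℂ) + w * I)⁻¹‖, sq_nonneg ‖((u : ℂ) + (w + 1 : ℝ) * I)⁻¹‖]

open Filter Topology Complex in
/-- The residue theorem for `f z / (z (z + i))` on the strip `a ≤ Im z ≤ b` containing both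
poles. -/
lemma integral_sub_integral_div_mul_add_I {f : ℂ → ℂ} {s : Set ℂ} {a b M : ℝ} (ha : a < -1)
    (hb : 0 < b) (hso : IsOpen s) (hs : ∀ z : ℂ, z.im ∈ Set.Icc a b → z ∈ s)
    (hd : DifferentiableOn ℂ f s) (hM : ∀ z : ℂ, z.im ∈ Set.Icc a b → ‖f z‖ ≤ M) :
    (∫ u : ℝ, f (u + a * I) / (((u : ℂ) + a * I) * (u + a * I + I))) -
      (∫ u : ℝ, f (u + b * I) / (((u : ℂ) + b * I) * (u + b * I + I))) =
      2 * Real.pi * (f 0 - f (-I)) := by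
  have h0s : (0 : ℂ) ∈ s := hs 0 ⟨by simp; linarith, by simpa using hb.le⟩
  have hIs : -I ∈ s := hs (-I) ⟨by simpa using ha.le, by simp; linarith⟩
  set h : ℂ → ℂ := dslope (dslope f 0) (-I) with hh
  have hhd : DifferentiableOn ℂ h s :=
    (differentiableOn_dslope (hso.mem_nhds hIs)).2
      ((differentiableOn_dslope (hso.mem_nhds h0s)).2 hd)
  have heq : ∀ z : ℂ, z ≠ 0 → z + I ≠ 0 →
      h z = f z / (z * (z + I)) + I * f 0 * z⁻¹ - I * f (-I) * (z + I)⁻¹ := by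
    intro z hz hzI
    have hI : -I ≠ 0 := neg_ne_zero.mpr I_ne_zero
    have hz' : z ≠ -I := fun e => hzI (by rw [e]; ring)
    rw [hh, dslope_of_ne _ hz', slope_def_field, dslope_of_ne _ hz, dslope_of_ne _ hI,
      slope_def_field, slope_def_field, sub_neg_eq_add, sub_zero, sub_zero]
    have := I_ne_zero
    field_simp
    ring_nf
    simp only [I_sq, I_pow_three]
    ring
  have hbound : ∀ z : ℂ, z.im ∈ Set.Icc a b → 1 ≤ |z.re| →
      ‖h z‖ ≤ (M + ‖f 0‖ + ‖f (-I)‖) / |z.re| := by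
    intro z hz hre
    have hz0 : 1 ≤ ‖z‖ := hre.trans (abs_re_le_norm z)
    have hn1 : |z.re| ≤ ‖z + I‖ := by simpa using abs_re_le_norm (z + I)
    have hz1 : 1 ≤ ‖z + I‖ := hre.trans hn1
    have hr : 0 < |z.re| := by linarith
    have hM0 : 0 ≤ M := (norm_nonneg _).trans (hM z hz)
    rw [heq z (norm_pos_iff.mp (by linarith)) (norm_pos_iff.mp (by linarith))]
    refine ((norm_sub_le _ _).trans (add_le_add_left (norm_add_le _ _) _)).trans ?_
    simp only [norm_div, norm_mul, norm_I, one_mul, add_div, ← div_eq_mul_inv]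
    have hzr : |z.re| ≤ ‖z‖ * ‖z + I‖ := by nlinarith
    gcongr
    · exact hM z hz
    · exact abs_re_le_norm z
  have hlim : ∀ {w : ℝ} {P Q : ℂ}, w ∈ Set.Icc a b → w ≠ 0 → w + 1 ≠ 0 →
      Tendsto (fun R : ℝ => ∫ u in (-R)..R, ((u : ℂ) + w * I)⁻¹) atTop (𝓝 P) →
      Tendsto (fun R : ℝ => ∫ u in (-R)..R, ((u : ℂ) + (w + 1 : ℝ) * I)⁻¹) atTop (𝓝 Q) →
      Tendsto (fun R : ℝ => ∫ u in (-R)..R, h (u + w * I)) atTop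
        (𝓝 ((∫ u : ℝ, f (u + w * I) / (((u : ℂ) + w * I) * (u + w * I + I))) +
          I * f 0 * P - I * f (-I) * Q)) := by
    intro w P Q hw hw0 hw1 hP hQ
    have hline : ∀ u : ℝ, ((u : ℂ) + w * I).im ∈ Set.Icc a b := fun u => by simpa using hw
    have hint := integrable_div_mul_add_I (f := fun u : ℝ => f (u + w * I))
      (hd.continuousOn.comp_continuous (by fun_prop) fun u => hs _ (hline u))
      (fun u => hM _ (hline u)) hw0 hw1
    have hG := intervalIntegral_tendsto_integral hint tendsto_neg_atTop_atBot tendsto_id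
    refine ((hG.add (hP.const_mul (I * f 0))).sub (hQ.const_mul (I * f (-I)))).congr fun R => ?_
    have e : ∀ u : ℝ, (u : ℂ) + (w + 1 : ℝ) * I = u + w * I + I := fun u => by push_cast; ring
    have i0 := (continuous_inv_ofReal_add_mul_I hw0).intervalIntegrable (μ := volume) (-R) R
    have i1 := (continuous_inv_ofReal_add_mul_I hw1).intervalIntegrable (μ := volume) (-R) R
    have hne := ofReal_add_mul_I_ne_zero hw1
    simp_rw [e] at i1 hne ⊢
    simp_rw [heq _ (ofReal_add_mul_I_ne_zero hw0 _) (hne _)]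
    rw [intervalIntegral.integral_sub (hint.intervalIntegrable.add (i0.const_mul _))
      (i1.const_mul _), intervalIntegral.integral_add hint.intervalIntegrable (i0.const_mul _),
      intervalIntegral.integral_const_mul, intervalIntegral.integral_const_mul]
    rfl
  have hab : a ≤ b := by linarith
  have hA := hlim (Set.left_mem_Icc.2 hab) (by linarith : a < 0).ne (by linarith : a + 1 < 0).ne
    (tendsto_integral_inv_ofReal_add_mul_I_of_neg (by linarith))
    (tendsto_integral_inv_ofReal_add_mul_I_of_neg (by linarith))
  have hB := hlim (Set.right_mem_Icc.2 hab) hb.ne' (by linarith : 0 < b + 1).ne'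
    (tendsto_integral_inv_ofReal_add_mul_I_of_pos hb)
    (tendsto_integral_inv_ofReal_add_mul_I_of_pos (by linarith))
  have key := tendsto_nhds_unique (hA.sub hB) (tendsto_integral_strip_sub_zero hab hs hhd hbound)
  linear_combination key - 2 * Real.pi * (f 0 - f (-I)) * I_sq

theorem stmt13 (μm μp S₀ K : ℝ) (hμm : μm < -1) (hμp : 0 < μp) (hS : 0 < S₀) (hK : 0 < K)
    (Φ : ℂ → ℂ)
    (hΦd : DifferentiableOn ℂ Φ {z : ℂ | μm < z.im ∧ z.im < μp})
    (hΦb : ∃ M : ℝ, ∀ z ∈ {z : ℂ | μm < z.im ∧ z.im < μp}, ‖Φ z‖ ≤ M)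
    (hΦ0 : Φ 0 = 1)
    (ω₁ ω₂ : ℝ) (hω₁ : ω₁ ∈ Set.Ioo μm (-1)) (hω₂ : ω₂ ∈ Set.Ioo 0 μp) :
    Integrable (fun u : ℝ => priceIntegrand Φ S₀ K ω₁ u) ∧
    Integrable (fun u : ℝ => priceIntegrand Φ S₀ K ω₂ u) ∧
    (-((K / (2 * Real.pi) : ℝ) : ℂ) * ∫ u : ℝ, priceIntegrand Φ S₀ K ω₁ u) -
      (-((K / (2 * Real.pi) : ℝ) : ℂ) * ∫ u : ℝ, priceIntegrand Φ S₀ K ω₂ u) =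
      (S₀ : ℂ) * Φ (-Complex.I) - (K : ℂ) := by
  set s : Set ℂ := {z : ℂ | μm < z.im ∧ z.im < μp} with hsdef
  obtain ⟨M, hM⟩ := hΦb
  have hso : IsOpen s := (isOpen_lt continuous_const Complex.continuous_im).inter
    (isOpen_lt Complex.continuous_im continuous_const)
  have hs : ∀ z : ℂ, z.im ∈ Set.Icc ω₁ ω₂ → z ∈ s := fun z hz =>
    ⟨hω₁.1.trans_le hz.1, hz.2.trans_lt hω₂.2⟩
  obtain ⟨ha1, ha⟩ := hω₁
  obtain ⟨hb, hb1⟩ := hω₂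
  set L : ℝ := Real.log (S₀ / K) with hL
  set f : ℂ → ℂ := fun z => Complex.exp (Complex.I * z * L) * Φ z with hf
  have hd : DifferentiableOn ℂ f s :=
    (by fun_prop : Differentiable ℂ fun z : ℂ =>
      Complex.exp (Complex.I * z * L)).differentiableOn.mul hΦd
  have hfM : ∀ z : ℂ, z.im ∈ Set.Icc ω₁ ω₂ →
      ‖f z‖ ≤ Real.exp (max |ω₁| |ω₂| * |L|) * M := by
    intro z hz
    rw [hf, norm_mul, Complex.norm_exp]
    refine mul_le_mul (Real.exp_le_exp.2 ?_) (hM z (hs z hz)) (norm_nonneg _)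
      (Real.exp_pos _).le
    calc (Complex.I * z * L).re = -z.im * L := by simp
      _ ≤ |-z.im * L| := le_abs_self _
      _ = |z.im| * |L| := by rw [abs_mul, abs_neg]
      _ ≤ max |ω₁| |ω₂| * |L| := by
        gcongr
        exact abs_le_max_abs_abs hz.1 hz.2
  have hprice : ∀ ω : ℝ, (fun u : ℝ => priceIntegrand Φ S₀ K ω u) = fun u : ℝ =>
      f (u + ω * Complex.I) / (((u : ℂ) + ω * Complex.I) * (u + ω * Complex.I + Complex.I)) := by
    intro ω
    funext u
    simp only [priceIntegrand, hf, mul_comm Complex.I (ω : ℂ), hL]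
  have hint : ∀ ω ∈ Set.Icc ω₁ ω₂, ω ≠ 0 → ω + 1 ≠ 0 →
      Integrable fun u : ℝ => priceIntegrand Φ S₀ K ω u := by
    intro ω hω h0 h1
    have hline : ∀ u : ℝ, ((u : ℂ) + ω * Complex.I).im ∈ Set.Icc ω₁ ω₂ := fun u => by
      simpa using hω
    rw [hprice]
    exact integrable_div_mul_add_I (f := fun u : ℝ => f (u + ω * Complex.I))
      (hd.continuousOn.comp_continuous (by fun_prop) fun u => hs _ (hline u))
      (fun u => hfM _ (hline u)) h0 h1
  have hab : ω₁ ≤ ω₂ := by linarith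
  refine ⟨hint ω₁ (Set.left_mem_Icc.2 hab) (by linarith : ω₁ < 0).ne
    (by linarith : ω₁ + 1 < 0).ne, hint ω₂ (Set.right_mem_Icc.2 hab) hb.ne'
    (by linarith : 0 < ω₂ + 1).ne', ?_⟩
  have key := integral_sub_integral_div_mul_add_I ha hb hso hs hd hfM
  have hf0 : f 0 = 1 := by simp [hf, hΦ0]
  have hfI : f (-Complex.I) = (S₀ / K : ℝ) * Φ (-Complex.I) := by
    have : Complex.I * -Complex.I * L = (L : ℂ) := by
      linear_combination (-L : ℂ) * Complex.I_sq
    simp only [hf]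
    rw [this, ← Complex.ofReal_exp, hL, Real.exp_log (div_pos hS hK)]
  rw [hf0, hfI] at key
  rw [hprice, hprice, ← mul_sub, key]
  have hKc : (K : ℂ) ≠ 0 := by exact_mod_cast hK.ne'
  have hpi : (Real.pi : ℂ) ≠ 0 := by exact_mod_cast Real.pi_ne_zero
  push_cast
  field_simp
  ring
end

section
/- Let μ₋ < −1 < 0 < μ₊ and x ∈ ℝ. Let f, g : ℂ → ℂ be holomorphic on the open strip S = {z : μ₋ < Im z < μ₊}, with f(0) = g(0) and f(−i) = g(−i). Assume that for every compact interval [a,b] ⊂ (μ₋, μ₊): (i) sup_{ω ∈ [a,b]} ∫_ℝ |(f−g)(u+iω)| du < ∞, and (ii) (f−g)(u+iω) → 0 as |u| → ∞, uniformly in ω ∈ [a,b]. Then for all ω₁, ω₂ ∈ (μ₋, μ₊) \ {−1, 0}, ∫_ℝ e^{ix(u+iω₁)} (f−g)(u+iω₁) / ((u+iω₁)(u+iω₁+i)) du = ∫_ℝ e^{ix(u+iω₂)} (f−g)(u+iω₂) / ((u+iω₂)(u+iω₂+i)) du. -/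
open MeasureTheory Real ENNReal

/-- Horizontal line integrals of a holomorphic function on a closed strip agree on both edges when
the function vanishes uniformly at infinity in the strip. -/
theorem integral_horizontal_line_eq {F : ℂ → ℂ} {a b : ℝ}
    (hF : DifferentiableOn ℂ F {z : ℂ | a ≤ z.im ∧ z.im ≤ b}) (hab : a ≤ b)
    (ha : Integrable fun u : ℝ => F (u + Complex.I * a))
    (hb : Integrable fun u : ℝ => F (u + Complex.I * b))
    (hdecay : ∀ ε > (0 : ℝ), ∃ R : ℝ, ∀ u : ℝ, R ≤ |u| → ∀ ω ∈ Set.Icc a b,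
      ‖F (u + Complex.I * ω)‖ ≤ ε) :
    ∫ u : ℝ, F (u + Complex.I * a) = ∫ u : ℝ, F (u + Complex.I * b) := by
  have hta := intervalIntegral_tendsto_integral ha Filter.tendsto_neg_atTop_atBot Filter.tendsto_id
  have htb := intervalIntegral_tendsto_integral hb Filter.tendsto_neg_atTop_atBot Filter.tendsto_id
  refine sub_eq_zero.mp (tendsto_nhds_unique (hta.sub htb) ?_)
  rw [Metric.tendsto_atTop]
  intro ε hε
  have hL : 0 < 2 * (b - a) + 1 := by linarith
  obtain ⟨R, hR⟩ := hdecay (ε / (2 * (b - a) + 1)) (by positivity)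
  refine ⟨max R 0, fun T hT => ?_⟩
  have hT0 : 0 ≤ T := (le_max_right _ _).trans hT
  have hRT : R ≤ |T| := ((le_max_left _ _).trans hT).trans (le_abs_self T)
  have hside : ∀ v : ℝ, R ≤ |v| →
      ‖∫ y in a..b, F (v + y * Complex.I)‖ ≤ ε / (2 * (b - a) + 1) * (b - a) := by
    intro v hv
    have := intervalIntegral.norm_integral_le_of_norm_le_const
      (f := fun y : ℝ => F (v + y * Complex.I)) (a := a) (b := b)
      (C := ε / (2 * (b - a) + 1)) (fun y hy => by
        rw [Set.uIoc_of_le hab] at hy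
        rw [mul_comm (y : ℂ)]
        exact hR v hv y ⟨hy.1.le, hy.2⟩)
    rwa [abs_of_nonneg (sub_nonneg.mpr hab)] at this
  have hrect := Complex.integral_boundary_rect_eq_zero_of_differentiableOn F
    (⟨-T, a⟩ : ℂ) (⟨T, b⟩ : ℂ) (hF.mono fun z hz => by
      have := hz.2
      simpa [Set.uIcc_of_le hab] using this)
  simp only [smul_eq_mul] at hrect
  have h₁ := hside T hRT
  have h₂ := hside (-T) (by rwa [abs_neg])
  simp only [dist_zero_right, id]
  simp_rw [mul_comm Complex.I]
  have key : (∫ u in -T..T, F (u + a * Complex.I)) - (∫ u in -T..T, F (u + b * Complex.I)) =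
      Complex.I * (∫ y in a..b, F ((-T : ℝ) + y * Complex.I)) -
        Complex.I * ∫ y in a..b, F (T + y * Complex.I) := by
    linear_combination hrect
  rw [key]
  refine (norm_sub_le _ _).trans_lt ?_
  rw [norm_mul, norm_mul, Complex.norm_I, one_mul, one_mul]
  calc _ ≤ ε / (2 * (b - a) + 1) * (b - a) + ε / (2 * (b - a) + 1) * (b - a) := add_le_add h₂ h₁
    _ = ε * (2 * (b - a)) / (2 * (b - a) + 1) := by ring
    _ < ε := by rw [div_lt_iff₀ hL]; nlinarith

/-- A holomorphic function vanishing at `0` and `-I` is divisible by `z * (z + I)` among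
holomorphic functions. -/
theorem exists_differentiableOn_eq_div {h : ℂ → ℂ} {s : Set ℂ} (hs : IsOpen s)
    (hh : DifferentiableOn ℂ h s) (h0s : (0 : ℂ) ∈ s) (hIs : -Complex.I ∈ s)
    (h0 : h 0 = 0) (hI : h (-Complex.I) = 0) :
    ∃ q : ℂ → ℂ, DifferentiableOn ℂ q s ∧
      ∀ z, z ≠ 0 → z ≠ -Complex.I → q z = h z / (z * (z + Complex.I)) := by
  refine ⟨dslope (dslope h 0) (-Complex.I),
    (Complex.differentiableOn_dslope (hs.mem_nhds hIs)).mpr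
      ((Complex.differentiableOn_dslope (hs.mem_nhds h0s)).mpr hh), fun z hz hzI => ?_⟩
  rw [dslope_of_ne _ hzI, slope_def_field, dslope_of_ne _ hz,
    dslope_of_ne _ (neg_ne_zero.mpr Complex.I_ne_zero), slope_def_field, slope_def_field, h0, hI]
  simp only [sub_zero, zero_div, sub_neg_eq_add]
  rw [div_div]

theorem continuous_comp_horizontal_line {F : ℂ → ℂ} {c d ω : ℝ}
    (hF : DifferentiableOn ℂ F {z : ℂ | c < z.im ∧ z.im < d}) (hω : ω ∈ Set.Ioo c d) :
    Continuous fun u : ℝ => F (u + Complex.I * ω) :=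
  hF.continuousOn.comp_continuous (by fun_prop) fun u => by simpa using hω

theorem norm_exp_horizontal_line (x u ω : ℝ) :
    ‖Complex.exp (Complex.I * x * (u + Complex.I * ω))‖ = Real.exp (-(x * ω)) := by
  rw [Complex.norm_exp]
  congr 1
  simp

theorem stmt14 (μm μp x : ℝ) (hμm : μm < -1) (hμp : 0 < μp)
    (f g : ℂ → ℂ)
    (hf : DifferentiableOn ℂ f {z : ℂ | μm < z.im ∧ z.im < μp})
    (hg : DifferentiableOn ℂ g {z : ℂ | μm < z.im ∧ z.im < μp})
    (h0 : f 0 = g 0) (hmi : f (-Complex.I) = g (-Complex.I))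
    (hbound : ∀ a b : ℝ, μm < a → a ≤ b → b < μp →
      ∃ C : ℝ≥0∞, C < ⊤ ∧ ∀ ω ∈ Set.Icc a b,
        (∫⁻ u : ℝ, (‖f (u + Complex.I * ω) - g (u + Complex.I * ω)‖₊ : ℝ≥0∞)) ≤ C)
    (hdecay : ∀ a b : ℝ, μm < a → a ≤ b → b < μp →
      ∀ ε > (0 : ℝ), ∃ R : ℝ, ∀ u : ℝ, R ≤ |u| → ∀ ω ∈ Set.Icc a b,
        ‖f (u + Complex.I * ω) - g (u + Complex.I * ω)‖ ≤ ε)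
    (ω₁ ω₂ : ℝ) (hω₁ : ω₁ ∈ Set.Ioo μm μp) (hω₂ : ω₂ ∈ Set.Ioo μm μp)
    (hω₁m : ω₁ ≠ -1) (hω₁z : ω₁ ≠ 0) (hω₂m : ω₂ ≠ -1) (hω₂z : ω₂ ≠ 0) :
    (∫ u : ℝ, Complex.exp (Complex.I * x * (u + Complex.I * ω₁)) *
        (f (u + Complex.I * ω₁) - g (u + Complex.I * ω₁)) /
        ((u + Complex.I * ω₁) * (u + Complex.I * ω₁ + Complex.I))) =
    ∫ u : ℝ, Complex.exp (Complex.I * x * (u + Complex.I * ω₂)) *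
        (f (u + Complex.I * ω₂) - g (u + Complex.I * ω₂)) /
        ((u + Complex.I * ω₂) * (u + Complex.I * ω₂ + Complex.I)) := by
  set s : Set ℂ := {z : ℂ | μm < z.im ∧ z.im < μp} with hs
  have hs_open : IsOpen s :=
    (isOpen_lt continuous_const Complex.continuous_im).inter
      (isOpen_lt Complex.continuous_im continuous_const)
  obtain ⟨q, hq, hq_eq⟩ := exists_differentiableOn_eq_div
    (h := fun z => Complex.exp (Complex.I * x * z) * (f z - g z)) hs_open
    (DifferentiableOn.mul (by fun_prop) (hf.sub hg))
    (by simp only [hs, Set.mem_ofPred_eq, Complex.zero_im]; constructor <;> linarith)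
    (by simp only [hs, Set.mem_ofPred_eq, Complex.neg_im, Complex.I_im]; constructor <;> linarith)
    (by simp [h0]) (by simp [hmi])
  have hline : ∀ ω : ℝ, ω ≠ -1 → ω ≠ 0 → ∀ u : ℝ, q (u + Complex.I * ω) =
      Complex.exp (Complex.I * x * (u + Complex.I * ω)) *
        (f (u + Complex.I * ω) - g (u + Complex.I * ω)) /
        ((u + Complex.I * ω) * (u + Complex.I * ω + Complex.I)) := by
    intro ω h₁ h₂ u
    refine hq_eq _ (fun h => h₂ ?_) (fun h => h₁ ?_)
    · simpa using congrArg Complex.im h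
    · simpa using congrArg Complex.im h
  have hint : ∀ ω ∈ Set.Ioo μm μp, ω ≠ -1 → ω ≠ 0 →
      Integrable fun u : ℝ => q (u + Complex.I * ω) := by
    intro ω hω h₁ h₂
    have hfg : Integrable fun u : ℝ => f (u + Complex.I * ω) - g (u + Complex.I * ω) := by
      obtain ⟨C, hC, hle⟩ := hbound ω ω hω.1 le_rfl hω.2
      exact ⟨((continuous_comp_horizontal_line hf hω).sub
        (continuous_comp_horizontal_line hg hω)).aestronglyMeasurable,
        (hle ω ⟨le_rfl, le_rfl⟩).trans_lt hC⟩
    refine (hfg.norm.const_mul (Real.exp (-(x * ω)) / (|ω| * |ω + 1|))).mono'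
      (continuous_comp_horizontal_line hq hω).aestronglyMeasurable (.of_forall fun u => ?_)
    have hω1 : 0 < |ω + 1| := abs_pos.mpr fun h => h₁ (by linarith)
    have hω0 : 0 < |ω| := abs_pos.mpr h₂
    have hd₁ : |ω| ≤ ‖(u + Complex.I * ω : ℂ)‖ := by
      simpa using Complex.abs_im_le_norm (u + Complex.I * ω : ℂ)
    have hd₂ : |ω + 1| ≤ ‖(u + Complex.I * ω + Complex.I : ℂ)‖ := by
      simpa using Complex.abs_im_le_norm (u + Complex.I * ω + Complex.I : ℂ)
    rw [hline ω h₁ h₂, norm_div, norm_mul, norm_mul, norm_exp_horizontal_line, div_mul_eq_mul_div]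
    gcongr
  have hdec : ∀ a b : ℝ, μm < a → a ≤ b → b < μp → ∀ ε > (0 : ℝ), ∃ R : ℝ, ∀ u : ℝ, R ≤ |u| →
      ∀ ω ∈ Set.Icc a b, ‖q (u + Complex.I * ω)‖ ≤ ε := by
    intro a b ha hab hb ε hε
    set M := Real.exp (|x| * max |a| |b|) with hM
    have hM0 : 0 < M := Real.exp_pos _
    obtain ⟨R, hR⟩ := hdecay a b ha hab hb (ε / M) (by positivity)
    refine ⟨max R 1, fun u hu ω hω => ?_⟩
    have hu1 : 1 ≤ |u| := (le_max_right _ _).trans hu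
    have hd₁ : 1 ≤ ‖(u + Complex.I * ω : ℂ)‖ := hu1.trans <| by
      simpa using Complex.abs_re_le_norm (u + Complex.I * ω : ℂ)
    have hd₂ : 1 ≤ ‖(u + Complex.I * ω + Complex.I : ℂ)‖ := hu1.trans <| by
      simpa using Complex.abs_re_le_norm (u + Complex.I * ω + Complex.I : ℂ)
    have hexp : Real.exp (-(x * ω)) ≤ M := by
      refine Real.exp_le_exp.mpr ((neg_le_abs _).trans ?_)
      rw [abs_mul]
      gcongr
      exact abs_le_max_abs_abs hω.1 hω.2
    have hne : ∀ c : ℂ, c.re = 0 → (u + Complex.I * ω : ℂ) ≠ c := by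
      intro c hc h
      have hu0 : u = 0 := by simpa [hc] using congrArg Complex.re h
      norm_num [hu0] at hu1
    rw [hq_eq _ (hne 0 rfl) (hne _ (by simp)), norm_div, norm_mul, norm_mul,
      norm_exp_horizontal_line]
    calc _ ≤ Real.exp (-(x * ω)) * ‖f (u + Complex.I * ω) - g (u + Complex.I * ω)‖ :=
          div_le_self (by positivity) (one_le_mul_of_one_le_of_one_le hd₁ hd₂)
      _ ≤ M * (ε / M) :=
          mul_le_mul hexp (hR u ((le_max_left _ _).trans hu) ω hω) (norm_nonneg _) hM0.le
      _ = ε := mul_div_cancel₀ _ hM0.ne'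
  simp_rw [← hline ω₁ hω₁m hω₁z, ← hline ω₂ hω₂m hω₂z]
  have hi₁ := hint ω₁ hω₁ hω₁m hω₁z
  have hi₂ := hint ω₂ hω₂ hω₂m hω₂z
  rcases le_total ω₁ ω₂ with h | h
  · exact integral_horizontal_line_eq
      (hq.mono fun z hz => ⟨hω₁.1.trans_le hz.1, hz.2.trans_lt hω₂.2⟩) h hi₁ hi₂
      (hdec _ _ hω₁.1 h hω₂.2)
  · exact (integral_horizontal_line_eq
      (hq.mono fun z hz => ⟨hω₂.1.trans_le hz.1, hz.2.trans_lt hω₁.2⟩) h hi₂ hi₁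
      (hdec _ _ hω₂.1 h hω₁.2)).symm
end

section
/- Let d > 0 and ζ > 0. Let f : ℂ → ℂ be holomorphic on the open strip S = {z : |Im z| < d}. Assume there is H > 0 with ∫_ℝ |f(u+iω)| du ≤ H for all ω ∈ (−d, d), and that ∫_{−d}^{d} |f(η+iω)| dω → 0 as η → ±∞ (η real). Then f restricted to ℝ is integrable, the series ζ Σ_{j∈ℤ} f(jζ) converges absolutely, and the discretization error of the infinite trapezoid rule satisfies | ∫_ℝ f(u) du − ζ Σ_{j∈ℤ} f(jζ) | ≤ ( e^{−2πd/ζ} / (1 − e^{−2πd/ζ}) ) · 2H. -/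
open MeasureTheory Real ENNReal Filter

theorem measurable_indicator_enorm_of_continuousOn {f : ℂ → ℂ} {s : Set ℂ} (hs : IsOpen s)
    (hf : ContinuousOn f s) : Measurable (s.indicator fun w => ‖f w‖ₑ) := by
  classical
  rw [← Set.piecewise_eq_indicator]
  refine measurable_of_restrict_of_restrict_compl hs.measurableSet ?_ ?_
  · rw [Set.domRestrict_piecewise]
    exact (continuousOn_iff_continuous_domRestrict.1 hf).enorm.measurable
  · rw [Set.domRestrict_piecewise_compl]
    exact measurable_const

theorem two_pi_mul_enorm_le_lintegral_circleMap {f : ℂ → ℂ} {z : ℂ} {r s : ℝ} (hs : 0 < s)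
    (hsr : s < r) (hf : DifferentiableOn ℂ f (Metric.ball z r)) :
    ENNReal.ofReal (2 * π) * ‖f z‖ₑ ≤ ∫⁻ θ in Set.Ioo (-π) π, ‖f (circleMap z s θ)‖ₑ := by
  have hd : DiffContOnCl ℂ f (Metric.ball z |s|) := by
    refine DifferentiableOn.diffContOnCl (hf.mono ?_)
    rw [closure_ball _ (abs_pos.2 hs.ne').ne', abs_of_pos hs]
    exact Metric.closedBall_subset_ball hsr
  have h1 := hd.circleAverage
  rw [circleAverage_eq_integral_add (-π),
    intervalIntegral.integral_comp_add_right (fun θ => f (circleMap z s θ))] at h1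
  have h2 : (2 * π) • f z = ∫ θ in Set.Ioo (-π) π, f (circleMap z s θ) := by
    rw [← h1, smul_smul, mul_inv_cancel₀ (by positivity), one_smul,
      intervalIntegral.integral_of_le (by linarith [pi_pos]), integral_Ioc_eq_integral_Ioo]
    congr 3 <;> ring_nf
  have h3 := enorm_integral_le_lintegral_enorm (μ := volume.restrict (Set.Ioo (-π) π))
    (fun θ => f (circleMap z s θ))
  rwa [← h2, enorm_smul, Real.enorm_eq_ofReal (by positivity)] at h3

theorem enorm_le_setLIntegral_ball {f : ℂ → ℂ} {z : ℂ} {r : ℝ} (hr : 0 < r)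
    (hf : DifferentiableOn ℂ f (Metric.ball z r)) :
    ENNReal.ofReal (π * r ^ 2 / 2) * ‖f z‖ₑ ≤ ∫⁻ w in Metric.ball z r, ‖f w‖ₑ := by
  set g : ℂ → ℝ≥0∞ := (Metric.ball z r).indicator fun w => ‖f w‖ₑ with hg
  have hgm : Measurable g :=
    measurable_indicator_enorm_of_continuousOn Metric.isOpen_ball hf.continuousOn
  rw [← lintegral_indicator measurableSet_ball, ← lintegral_add_right_eq_self _ z,
    ← Complex.lintegral_comp_polarCoord_symm]
  have hm : Measurable fun p : ℝ × ℝ =>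
      ENNReal.ofReal p.1 • g (Complex.polarCoord.symm p + z) := by
    simp only [Complex.polarCoord_symm_apply, smul_eq_mul]
    fun_prop
  rw [polarCoord_target, Measure.volume_eq_prod, ← Measure.prod_restrict,
    lintegral_prod _ hm.aemeasurable]
  calc ENNReal.ofReal (π * r ^ 2 / 2) * ‖f z‖ₑ
      = ∫⁻ s in Set.Ioo (r / 2) r, ENNReal.ofReal (r / 2) * (ENNReal.ofReal (2 * π) * ‖f z‖ₑ) := by
        rw [setLIntegral_const, Real.volume_Ioo, ← mul_assoc, ← ENNReal.ofReal_mul (by positivity),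
          mul_right_comm, ← ENNReal.ofReal_mul (by positivity)]
        congr 2
        ring
    _ ≤ ∫⁻ s in Set.Ioo (r / 2) r, ∫⁻ θ in Set.Ioo (-π) π,
          ENNReal.ofReal s • g (Complex.polarCoord.symm (s, θ) + z) := by
        refine setLIntegral_mono' measurableSet_Ioo fun s hs => ?_
        have hs0 : 0 < s := (half_pos hr).trans hs.1
        simp only [smul_eq_mul]
        rw [lintegral_const_mul' _ _ ENNReal.ofReal_ne_top]
        refine mul_le_mul' (ENNReal.ofReal_le_ofReal hs.1.le) ?_
        refine (two_pi_mul_enorm_le_lintegral_circleMap hs0 hs.2 hf).trans_eq ?_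
        congr 1 with θ
        have : Complex.polarCoord.symm (s, θ) + z = circleMap z s θ := by
          simp [circleMap, Complex.exp_mul_I, add_comm]
        rw [this, hg, Set.indicator_of_mem]
        rw [Metric.mem_ball, dist_eq_norm, circleMap_sub_center, norm_circleMap_zero,
          abs_of_pos hs0]
        exact hs.2
    _ ≤ _ := lintegral_mono_set fun s hs => (half_pos hr).trans hs.1

theorem isOpen_abs_im_lt (d : ℝ) : IsOpen {z : ℂ | |z.im| < d} :=
  isOpen_lt (by fun_prop) continuous_const

theorem setLIntegral_strip_le {d H : ℝ} {f : ℂ → ℂ}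
    (hf : ContinuousOn f {z : ℂ | |z.im| < d})
    (hnorm : ∀ ω ∈ Set.Ioo (-d) d,
      (∫⁻ u : ℝ, ‖f (u + Complex.I * ω)‖ₑ) ≤ ENNReal.ofReal H) :
    ∫⁻ w in {z : ℂ | |z.im| < d}, ‖f w‖ₑ ≤ ENNReal.ofReal H * ENNReal.ofReal (d - -d) := by
  have hm := measurable_indicator_enorm_of_continuousOn (isOpen_abs_im_lt d) hf
  have hm' : Measurable fun p : ℝ × ℝ => {z : ℂ | |z.im| < d}.indicator (fun w => ‖f w‖ₑ)
      (Complex.measurableEquivRealProd.symm p) :=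
    hm.comp Complex.measurableEquivRealProd.symm.measurable
  rw [← lintegral_indicator (isOpen_abs_im_lt d).measurableSet,
    ← (Complex.volume_preserving_equiv_real_prod.symm).lintegral_comp_emb
      Complex.measurableEquivRealProd.symm.measurableEmbedding,
    Measure.volume_eq_prod, lintegral_prod_symm' _ hm',
    ← Real.volume_Ioo, ← setLIntegral_const, ← lintegral_indicator measurableSet_Ioo]
  refine lintegral_mono fun ω => ?_
  by_cases hω : ω ∈ Set.Ioo (-d) d
  · rw [Set.indicator_of_mem hω]
    refine (lintegral_mono fun u => ?_).trans (hnorm ω hω)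
    have : Complex.measurableEquivRealProd.symm (u, ω) = u + Complex.I * ω := by
      apply Complex.ext <;> simp [Complex.measurableEquivRealProd]
    rw [this]
    exact Set.indicator_le_self _ _ _
  · rw [Set.indicator_of_notMem hω]
    refine (lintegral_eq_zero_of_ae_eq_zero (Eventually.of_forall fun u => ?_)).le
    refine Set.indicator_of_notMem (fun h => hω ?_) _
    simpa [Complex.measurableEquivRealProd, abs_lt] using h

theorem tsum_measure_re_preimage_Ioc_le (μ : Measure ℂ) (N : ℕ) :
    ∑' n : ℤ, μ (Complex.re ⁻¹' Set.Ioc (n - N : ℝ) (n + N)) ≤ (2 * N : ℕ) * μ Set.univ := by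
  have hsub : ∀ n : ℤ, Complex.re ⁻¹' Set.Ioc (n - N : ℝ) (n + N) ⊆
      ⋃ k ∈ Finset.range (2 * N),
        Complex.re ⁻¹' Set.Ioc ((k - N : ℝ) + n) ((k - N : ℝ) + n + 1) := by
    intro n z hz
    simp only [Set.mem_preimage, Set.mem_Ioc, Set.mem_iUnion, Finset.mem_range] at hz ⊢
    obtain ⟨m, hm⟩ := Set.mem_iUnion.1
      ((iUnion_Ioc_add_intCast (0 : ℝ)).symm ▸ Set.mem_univ (z.re - n + N))
    rw [Set.mem_Ioc] at hm
    have h0 : 0 ≤ m := by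
      have : (-1 : ℝ) < m := by linarith
      have : (-1 : ℤ) < m := by exact_mod_cast this
      omega
    have h1 : m < 2 * N := by
      have : (m : ℝ) < 2 * N := by linarith
      exact_mod_cast this
    lift m to ℕ using h0
    refine ⟨m, by omega, ?_, ?_⟩ <;> push_cast at hm <;> linarith
  calc ∑' n : ℤ, μ (Complex.re ⁻¹' Set.Ioc (n - N : ℝ) (n + N))
      ≤ ∑' n : ℤ, ∑ k ∈ Finset.range (2 * N),
          μ (Complex.re ⁻¹' Set.Ioc ((k - N : ℝ) + n) ((k - N : ℝ) + n + 1)) :=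
        ENNReal.tsum_le_tsum fun n =>
          (measure_mono (hsub n)).trans (measure_biUnion_finset_le _ _)
    _ = ∑ k ∈ Finset.range (2 * N), ∑' n : ℤ,
          μ (Complex.re ⁻¹' Set.Ioc ((k - N : ℝ) + n) ((k - N : ℝ) + n + 1)) :=
        Summable.tsum_finsetSum fun _ _ => ENNReal.summable
    _ ≤ ∑ k ∈ Finset.range (2 * N), μ Set.univ := by
        refine Finset.sum_le_sum fun k _ => ?_
        rw [← measure_iUnion]
        · exact measure_mono (Set.subset_univ _)
        · exact fun i j hij => (Set.pairwise_disjoint_Ioc_add_intCast (k - N : ℝ) hij).preimage _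
        · exact fun n => Complex.measurable_re measurableSet_Ioc
    _ = (2 * N : ℕ) * μ Set.univ := by simp

theorem exists_summable_bound_translates {c d H : ℝ} (hcd : c < d) {f : ℂ → ℂ}
    (hf : DifferentiableOn ℂ f {z : ℂ | |z.im| < d})
    (hnorm : ∀ ω ∈ Set.Ioo (-d) d,
      (∫⁻ u : ℝ, ‖f (u + Complex.I * ω)‖ₑ) ≤ ENNReal.ofReal H) (N : ℕ) :
    ∃ a : ℤ → ℝ, Summable a ∧
      ∀ (n : ℤ) (z : ℂ), |z.re| ≤ N → |z.im| ≤ c → ‖f (z + n)‖ ≤ a n := by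
  set S := {z : ℂ | |z.im| < d} with hS
  set r := min (d - c) 1 with hr
  have hr0 : 0 < r := lt_min (by linarith) one_pos
  set μ := (volume.restrict S).withDensity (fun w => ‖f w‖ₑ) with hμ
  set C := ENNReal.ofReal (π * r ^ 2 / 2) with hC
  have hC0 : C ≠ 0 := by
    rw [hC, Ne, ENNReal.ofReal_eq_zero, not_le]
    positivity
  have hμfin : μ Set.univ ≠ ⊤ := by
    rw [hμ, withDensity_apply _ MeasurableSet.univ, Measure.restrict_univ]
    exact ((setLIntegral_strip_le hf.continuousOn hnorm).trans_lt
      (ENNReal.mul_lt_top ENNReal.ofReal_lt_top ENNReal.ofReal_lt_top)).ne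
  set A : ℤ → Set ℂ := fun n => Complex.re ⁻¹' Set.Ioc (n - (N + 1 : ℕ) : ℝ) (n + (N + 1 : ℕ))
    with hA
  have hsum : ∑' n, C⁻¹ * μ (A n) ≠ ⊤ := by
    rw [ENNReal.tsum_mul_left]
    exact ENNReal.mul_ne_top (ENNReal.inv_ne_top.2 hC0)
      ((tsum_measure_re_preimage_Ioc_le μ (N + 1)).trans_lt
        (ENNReal.mul_lt_top (ENNReal.natCast_lt_top _) hμfin.lt_top)).ne
  refine ⟨fun n => (C⁻¹ * μ (A n)).toReal, ENNReal.summable_toReal hsum, fun n z hre him => ?_⟩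
  have hball : Metric.ball (z + n) r ⊆ A n ∩ S := by
    intro w hw
    rw [Metric.mem_ball, dist_eq_norm] at hw
    have h1 := (abs_lt.1 ((Complex.abs_re_le_norm _).trans_lt hw))
    have h2 := (Complex.abs_im_le_norm _).trans_lt hw
    simp only [Complex.sub_re, Complex.add_re, Complex.intCast_re, Complex.sub_im,
      Complex.add_im, Complex.intCast_im, add_zero] at h1 h2
    have h3 := abs_le.1 hre
    have h4 : r ≤ 1 := min_le_right _ _
    have h5 : r ≤ d - c := min_le_left _ _
    refine ⟨⟨?_, ?_⟩, ?_⟩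
    · push_cast; linarith
    · push_cast; linarith
    · have := abs_sub_abs_le_abs_sub w.im z.im
      rw [hS, Set.mem_ofPred_eq]
      linarith
  have hAm : MeasurableSet (A n) := Complex.measurable_re measurableSet_Ioc
  have key : C * ‖f (z + n)‖ₑ ≤ μ (A n) := by
    refine (enorm_le_setLIntegral_ball hr0 (hf.mono fun w hw => (hball hw).2)).trans ?_
    rw [hμ, withDensity_apply _ hAm, Measure.restrict_restrict hAm]
    exact lintegral_mono_set hball
  rw [← toReal_enorm]
  refine ENNReal.toReal_mono (ENNReal.ne_top_of_tsum_ne_top hsum n) ?_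
  rw [mul_comm, ← div_eq_mul_inv, ENNReal.le_div_iff_mul_le (Or.inl hC0)
    (Or.inl ENNReal.ofReal_ne_top), mul_comm]
  exact key

theorem integral_eq_integral_add_I_mul {F : ℂ → ℂ} {c : ℝ} {b : ℕ → ℝ}
    (hF : DifferentiableOn ℂ F {z : ℂ | |z.im| ≤ |c|})
    (h0 : Integrable fun u : ℝ => F u) (hc : Integrable fun u : ℝ => F (u + Complex.I * c))
    (hb : Tendsto b atTop (nhds 0))
    (hright : ∀ (n : ℕ) (y : ℝ), |y| ≤ |c| → ‖F (n + y * Complex.I)‖ ≤ b n)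
    (hleft : ∀ (n : ℕ) (y : ℝ), |y| ≤ |c| → ‖F (-n + y * Complex.I)‖ ≤ b n) :
    ∫ u : ℝ, F u = ∫ u : ℝ, F (u + Complex.I * c) := by
  have habs : ∀ y ∈ Set.uIcc 0 c, |y| ≤ |c| := fun y hy => by
    simpa using Set.abs_sub_left_of_mem_uIcc hy
  have hside : ∀ G : ℕ → ℝ → ℂ, (∀ n y, |y| ≤ |c| → ‖G n y‖ ≤ b n) →
      Tendsto (fun n => Complex.I • ∫ y in (0 : ℝ)..c, G n y) atTop (nhds 0) := by
    intro G hG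
    refine squeeze_zero_norm (a := fun n => b n * |c - 0|) (fun n => ?_)
      (by simpa using hb.mul_const |c - 0|)
    rw [norm_smul, Complex.norm_I, one_mul]
    exact intervalIntegral.norm_integral_le_of_norm_le_const fun y hy =>
      hG n y (habs y (Set.uIoc_subset_uIcc hy))
  have hneg : Tendsto (fun n : ℕ => -(n : ℝ)) atTop atBot :=
    tendsto_neg_atTop_atBot.comp tendsto_natCast_atTop_atTop
  have hb0 := intervalIntegral_tendsto_integral h0 hneg tendsto_natCast_atTop_atTop
  have hbc := intervalIntegral_tendsto_integral hc hneg tendsto_natCast_atTop_atTop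
  have hlim := (((hb0.sub hbc).add (hside _ hright)).sub (hside _ hleft))
  have hzero : ∀ n : ℕ, (∫ x in (-n : ℝ)..n, F x) - (∫ x in (-n : ℝ)..n, F (x + Complex.I * c)) +
      (Complex.I • ∫ y in (0 : ℝ)..c, F (n + y * Complex.I)) -
      (Complex.I • ∫ y in (0 : ℝ)..c, F (-n + y * Complex.I)) = 0 := by
    intro n
    have h := Complex.integral_boundary_rect_eq_zero_of_differentiableOn F (-n : ℂ)
      (n + c * Complex.I) (hF.mono fun z hz => habs _ (by simpa using hz.2))
    simpa [mul_comm] using h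
  have := tendsto_nhds_unique (hlim.congr hzero) tendsto_const_nhds
  simpa [sub_eq_zero] using this

section StripFunctions

open FourierTransform

variable {d H : ℝ} {f : ℂ → ℂ}

theorem integrable_horizontal_line (hf : DifferentiableOn ℂ f {z : ℂ | |z.im| < d})
    (hnorm : ∀ ω ∈ Set.Ioo (-d) d,
      (∫⁻ u : ℝ, ‖f (u + Complex.I * ω)‖ₑ) ≤ ENNReal.ofReal H) {c : ℝ} (hc : |c| < d) :
    Integrable fun u : ℝ => f (u + Complex.I * c) := by
  refine ⟨Continuous.aestronglyMeasurable ?_,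
    (hnorm c (abs_lt.1 hc)).trans_lt ENNReal.ofReal_lt_top⟩
  exact hf.continuousOn.comp_continuous (by fun_prop) fun u => by simpa using hc

theorem norm_cexp_neg_two_pi_I_mul (ξ : ℝ) (z : ℂ) :
    ‖Complex.exp (-2 * π * Complex.I * ξ * z)‖ = Real.exp (2 * π * ξ * z.im) := by
  rw [Complex.norm_exp]
  congr 1
  simp

theorem fourier_eq_integral_shifted (hf : DifferentiableOn ℂ f {z : ℂ | |z.im| < d})
    (hnorm : ∀ ω ∈ Set.Ioo (-d) d,
      (∫⁻ u : ℝ, ‖f (u + Complex.I * ω)‖ₑ) ≤ ENNReal.ofReal H) {c : ℝ} (hc : |c| < d) (ξ : ℝ) :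
    𝓕 (fun u : ℝ => f u) ξ = ∫ u : ℝ,
      Complex.exp (-2 * π * Complex.I * ξ * (u + Complex.I * c)) * f (u + Complex.I * c) := by
  set F : ℂ → ℂ := fun z => Complex.exp (-2 * π * Complex.I * ξ * z) * f z with hFdef
  obtain ⟨a, ha, hab⟩ := exists_summable_bound_translates hc hf hnorm 0
  have hF : ∀ (y : ℝ), |y| ≤ |c| → ∀ n : ℤ,
      ‖F (n + y * Complex.I)‖ ≤ Real.exp (2 * π * |ξ| * |c|) * a n := by
    intro y hy n
    rw [hFdef, norm_mul, norm_cexp_neg_two_pi_I_mul]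
    refine mul_le_mul (Real.exp_le_exp.2 ?_) ?_ (norm_nonneg _) (Real.exp_pos _).le
    · rw [mul_assoc (2 * π), mul_assoc (2 * π)]
      refine mul_le_mul_of_nonneg_left ?_ (by positivity)
      simp only [Complex.add_im, Complex.intCast_im, Complex.mul_im, Complex.ofReal_re,
        Complex.I_im, mul_one, Complex.ofReal_im, Complex.I_re, mul_zero, add_zero, zero_add]
      exact (le_abs_self _).trans ((abs_mul _ _).le.trans
        (mul_le_mul_of_nonneg_left hy (abs_nonneg _)))
    · rw [add_comm]
      exact hab n _ (by simp) (by simpa using hy)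
  have hint : ∀ y : ℝ, |y| < d → Integrable fun u : ℝ => F (u + Complex.I * y) := by
    intro y hy
    refine (integrable_horizontal_line hf hnorm hy).bdd_mul (c := Real.exp (2 * π * ξ * y))
      (Continuous.aestronglyMeasurable (by fun_prop)) (Eventually.of_forall fun u => ?_)
    rw [norm_cexp_neg_two_pi_I_mul]
    simp
  have hcof := ha.tendsto_cofinite_zero
  have hpos : Tendsto (fun n : ℕ => a n) atTop (nhds 0) := by
    rw [← Nat.cofinite_eq_atTop]
    exact hcof.comp Nat.cast_injective.tendsto_cofinite
  have hneg : Tendsto (fun n : ℕ => a (-n)) atTop (nhds 0) := by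
    rw [← Nat.cofinite_eq_atTop]
    exact hcof.comp (neg_injective.comp Nat.cast_injective).tendsto_cofinite
  have ha0 : ∀ n, 0 ≤ a n := fun n => (norm_nonneg _).trans (hab n 0 (by simp) (by simp))
  have hE := (Real.exp_pos (2 * π * |ξ| * |c|)).le
  have h := integral_eq_integral_add_I_mul (F := F) (c := c)
    (b := fun n : ℕ => Real.exp (2 * π * |ξ| * |c|) * (a n + a (-n)))
    (((Complex.differentiable_exp.comp (by fun_prop)).differentiableOn.mul hf).mono
      fun z hz => lt_of_le_of_lt hz hc)
    (by simpa using hint 0 (by simpa using (abs_nonneg c).trans_lt hc)) (hint c hc)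
    (by simpa using (hpos.add hneg).const_mul (Real.exp (2 * π * |ξ| * |c|)))
    (fun n y hy => by
      simpa using (hF y hy n).trans
        (mul_le_mul_of_nonneg_left (le_add_of_nonneg_right (ha0 (-n))) hE))
    (fun n y hy => by
      simpa using (hF y hy (-n)).trans
        (mul_le_mul_of_nonneg_left (le_add_of_nonneg_left (ha0 n)) hE))
  rw [← h, Real.fourier_real_eq_integral_exp_smul]
  congr 1 with u
  rw [hFdef, smul_eq_mul]
  congr 2
  push_cast
  ring

theorem norm_fourier_le_of_strip (hd : 0 < d) (hH : 0 ≤ H)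
    (hf : DifferentiableOn ℂ f {z : ℂ | |z.im| < d})
    (hnorm : ∀ ω ∈ Set.Ioo (-d) d,
      (∫⁻ u : ℝ, ‖f (u + Complex.I * ω)‖ₑ) ≤ ENNReal.ofReal H) (ξ : ℝ) :
    ‖𝓕 (fun u : ℝ => f u) ξ‖ ≤ H * Real.exp (-2 * π * d * |ξ|) := by
  have hline : ∀ c : ℝ, |c| < d → ‖𝓕 (fun u : ℝ => f u) ξ‖ ≤ H * Real.exp (2 * π * ξ * c) := by
    intro c hc
    rw [fourier_eq_integral_shifted hf hnorm hc]
    refine (norm_integral_le_integral_norm _).trans ?_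
    have hn : ∀ u : ℝ, ‖Complex.exp (-2 * π * Complex.I * ξ * (u + Complex.I * c)) *
        f (u + Complex.I * c)‖ = Real.exp (2 * π * ξ * c) * ‖f (u + Complex.I * c)‖ := by
      intro u
      rw [norm_mul, norm_cexp_neg_two_pi_I_mul]
      simp
    simp_rw [hn]
    rw [integral_const_mul, mul_comm]
    refine mul_le_mul_of_nonneg_right ?_ (Real.exp_pos _).le
    rw [integral_norm_eq_lintegral_enorm (integrable_horizontal_line hf hnorm hc).1]
    exact ENNReal.toReal_le_of_le_ofReal hH (hnorm c (abs_lt.1 hc))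
  have hbound : ∀ c ∈ Set.Ioo 0 d, ‖𝓕 (fun u : ℝ => f u) ξ‖ ≤ H * Real.exp (-2 * π * c * |ξ|) := by
    intro c hc
    rcases le_total 0 ξ with h | h
    · refine (hline (-c) (by rw [abs_neg, abs_of_pos hc.1]; exact hc.2)).trans_eq ?_
      rw [abs_of_nonneg h]
      ring_nf
    · refine (hline c (by rw [abs_of_pos hc.1]; exact hc.2)).trans_eq ?_
      rw [abs_of_nonpos h]
      ring_nf
  have hcont : Continuous fun c : ℝ => H * Real.exp (-2 * π * c * |ξ|) := by fun_prop
  refine ge_of_tendsto (hcont.continuousWithinAt (s := Set.Iio d) (x := d)).tendsto ?_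
  filter_upwards [Ioo_mem_nhdsLT hd] with c hc using hbound c hc

theorem summable_intCast_of_strip (hd : 0 < d)
    (hf : DifferentiableOn ℂ f {z : ℂ | |z.im| < d})
    (hnorm : ∀ ω ∈ Set.Ioo (-d) d,
      (∫⁻ u : ℝ, ‖f (u + Complex.I * ω)‖ₑ) ≤ ENNReal.ofReal H) :
    Summable fun n : ℤ => f n := by
  obtain ⟨a, ha, hab⟩ := exists_summable_bound_translates hd hf hnorm 0
  exact ha.of_norm_bounded fun n => by simpa using hab n 0 (by simp) (by simp)

theorem tsum_intCast_eq_tsum_fourier_of_strip (hd : 0 < d)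
    (hf : DifferentiableOn ℂ f {z : ℂ | |z.im| < d})
    (hnorm : ∀ ω ∈ Set.Ioo (-d) d,
      (∫⁻ u : ℝ, ‖f (u + Complex.I * ω)‖ₑ) ≤ ENNReal.ofReal H)
    (hsum : Summable fun n : ℤ => 𝓕 (fun u : ℝ => f u) n) :
    ∑' n : ℤ, f n = ∑' n : ℤ, 𝓕 (fun u : ℝ => f u) n := by
  have hcont : Continuous fun u : ℝ => f u :=
    hf.continuousOn.comp_continuous (by fun_prop) fun u => by simpa using hd
  have h := Real.tsum_eq_tsum_fourier (f := ⟨fun u : ℝ => f u, hcont⟩) ?_ hsum 0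
  · simpa using h
  · intro K
    obtain ⟨R, hR⟩ := K.isCompact.isBounded.exists_norm_le
    obtain ⟨N, hN⟩ := exists_nat_ge R
    obtain ⟨a, ha, hab⟩ := exists_summable_bound_translates hd hf hnorm N
    have ha0 : ∀ n, 0 ≤ a n := fun n => (norm_nonneg _).trans (hab n 0 (by simp) (by simp))
    refine Summable.of_nonneg_of_le (fun _ => norm_nonneg _) (fun n => ?_) ha
    rw [ContinuousMap.norm_le _ (ha0 n)]
    rintro ⟨x, hx⟩
    have h := hab n x (by simpa using (hR x hx).trans hN) (by simp)
    rw [← Complex.ofReal_intCast, ← Complex.ofReal_add] at h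
    exact h

theorem norm_integral_sub_tsum_intCast_le (hd : 0 < d) (hH : 0 ≤ H)
    (hf : DifferentiableOn ℂ f {z : ℂ | |z.im| < d})
    (hnorm : ∀ ω ∈ Set.Ioo (-d) d,
      (∫⁻ u : ℝ, ‖f (u + Complex.I * ω)‖ₑ) ≤ ENNReal.ofReal H) :
    ‖(∫ u : ℝ, f u) - ∑' n : ℤ, f n‖ ≤
      Real.exp (-2 * π * d) / (1 - Real.exp (-2 * π * d)) * (2 * H) := by
  set q := Real.exp (-2 * π * d) with hq
  have hq1 : q < 1 := by
    rw [hq, Real.exp_lt_one_iff]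
    have := mul_pos pi_pos hd
    linarith
  have hq0 : 0 ≤ q := (Real.exp_pos _).le
  have hgeom : HasSum (fun n : ℕ => H * q ^ (n + 1)) (H * (q / (1 - q))) := by
    have := (hasSum_geometric_of_lt_one hq0 hq1).mul_left (H * q)
    rw [div_eq_mul_inv, ← mul_assoc]
    simpa only [pow_succ', mul_assoc] using this
  set c : ℤ → ℂ := fun n => 𝓕 (fun u : ℝ => f u) n with hc
  have hbound : ∀ n : ℤ, ‖c n‖ ≤ H * q ^ n.natAbs := by
    intro n
    refine (norm_fourier_le_of_strip hd hH hf hnorm n).trans_eq ?_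
    rw [hq, ← Real.exp_nat_mul, Nat.cast_natAbs, Int.cast_abs]
    ring_nf
  have hp : ∀ n : ℕ, ‖c (n + 1)‖ ≤ H * q ^ (n + 1) := fun n => hbound (n + 1)
  have hm : ∀ n : ℕ, ‖c (-(n + 1))‖ ≤ H * q ^ (n + 1) := fun n => by
    have := hbound (-(n + 1))
    rwa [Int.natAbs_neg] at this
  have hsp := hgeom.summable.of_norm_bounded hp
  have hsm := hgeom.summable.of_norm_bounded hm
  have hs := HasSum.of_add_one_of_neg_add_one hsp.hasSum hsm.hasSum
  have h0 : c 0 = ∫ u : ℝ, f u := by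
    simp [hc, Real.fourier_real_eq_integral_exp_smul]
  rw [tsum_intCast_eq_tsum_fourier_of_strip hd hf hnorm hs.summable, hs.tsum_eq, h0]
  calc _ = ‖(∑' n : ℕ, c (n + 1)) + ∑' n : ℕ, c (-(n + 1))‖ := by
        rw [← norm_neg]
        congr 1
        ring
    _ ≤ H * (q / (1 - q)) + H * (q / (1 - q)) :=
        (norm_add_le _ _).trans (add_le_add (tsum_of_norm_bounded hgeom hp)
          (tsum_of_norm_bounded hgeom hm))
    _ = _ := by ring

end StripFunctions

theorem stmt15 (d ζ : ℝ) (hd : 0 < d) (hζ : 0 < ζ)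
    (f : ℂ → ℂ) (hf : DifferentiableOn ℂ f {z : ℂ | |z.im| < d})
    (H : ℝ) (hH : 0 < H)
    (hnorm : ∀ ω ∈ Set.Ioo (-d) d,
      (∫⁻ u : ℝ, (‖f (u + Complex.I * ω)‖₊ : ℝ≥0∞)) ≤ ENNReal.ofReal H)
    (hdecayTop : Tendsto (fun η : ℝ => ∫ ω in (-d)..d, ‖f (η + Complex.I * ω)‖)
      atTop (nhds 0))
    (hdecayBot : Tendsto (fun η : ℝ => ∫ ω in (-d)..d, ‖f (η + Complex.I * ω)‖)
      atBot (nhds 0)) :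
    Integrable (fun u : ℝ => f u) ∧
    Summable (fun j : ℤ => f ((j : ℝ) * ζ)) ∧
    ‖(∫ u : ℝ, f u) - (ζ : ℂ) * ∑' j : ℤ, f ((j : ℝ) * ζ)‖ ≤
      (Real.exp (-2 * Real.pi * d / ζ) / (1 - Real.exp (-2 * Real.pi * d / ζ))) * (2 * H) := by
  have hint : ∀ c : ℝ, |c| < d → Integrable fun u : ℝ => f (u + Complex.I * c) :=
    fun c => integrable_horizontal_line hf hnorm
  set g : ℂ → ℂ := fun z => f (z * ζ) with hg
  have hdζ : 0 < d / ζ := div_pos hd hζ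
  have hgd : DifferentiableOn ℂ g {z : ℂ | |z.im| < d / ζ} := by
    refine hf.comp (by fun_prop) fun z hz => ?_
    have hz' : |z.im| < d / ζ := hz
    rw [lt_div_iff₀ hζ] at hz'
    simpa [abs_mul, abs_of_pos hζ] using hz'
  have hgnorm : ∀ ω ∈ Set.Ioo (-(d / ζ)) (d / ζ),
      (∫⁻ u : ℝ, ‖g (u + Complex.I * ω)‖ₑ) ≤ ENNReal.ofReal (H / ζ) := by
    intro ω hω
    have hω' : |ω * ζ| < d := by
      have := abs_lt.2 hω
      rwa [lt_div_iff₀ hζ, ← abs_of_pos hζ, ← abs_mul] at this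
    have hscale : ∀ u : ℝ, g (u + Complex.I * ω) =
        f ((u * ζ : ℝ) + Complex.I * (ω * ζ : ℝ)) := by
      intro u
      rw [hg]
      push_cast
      ring_nf
    have hgi : Integrable fun u : ℝ => g (u + Complex.I * ω) := by
      simp_rw [hscale]
      exact (hint _ hω').comp_mul_right' hζ.ne'
    rw [← ofReal_integral_norm_eq_lintegral_enorm hgi]
    refine ENNReal.ofReal_le_ofReal ?_
    simp_rw [hscale]
    rw [Measure.integral_comp_mul_right (fun u : ℝ => ‖f (u + Complex.I * (ω * ζ : ℝ))‖) ζ,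
      abs_of_pos (inv_pos.2 hζ), smul_eq_mul, inv_mul_eq_div]
    refine div_le_div_of_nonneg_right ?_ hζ.le
    rw [integral_norm_eq_lintegral_enorm (hint _ hω').1]
    exact ENNReal.toReal_le_of_le_ofReal hH.le (hnorm _ (abs_lt.1 hω'))
  refine ⟨by simpa using hint 0 (by simpa using hd), ?_, ?_⟩
  · simpa [hg] using summable_intCast_of_strip hdζ hgd hgnorm
  · have h := norm_integral_sub_tsum_intCast_le hdζ (div_pos hH hζ).le hgd hgnorm
    have hI : (∫ u : ℝ, f u) = ζ * ∫ u : ℝ, g u := by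
      have := Measure.integral_comp_mul_right (fun u : ℝ => f u) ζ
      rw [abs_of_pos (inv_pos.2 hζ)] at this
      simp only [hg, ← Complex.ofReal_mul, this, Complex.real_smul, Complex.ofReal_inv]
      rw [mul_inv_cancel_left₀ (by exact_mod_cast hζ.ne')]
    have hS : ∑' j : ℤ, f ((j : ℝ) * ζ) = ∑' n : ℤ, g n := by simp [hg]
    rw [hI, hS, ← mul_sub, norm_mul, Complex.norm_of_nonneg hζ.le]
    refine (mul_le_mul_of_nonneg_left h hζ.le).trans_eq ?_
    rw [← mul_div_assoc]
    field_simp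
end

section
/- Let α ∈ (0,1), γ, θ, ν > 0, ρ ∈ (−1,1), T > 0, r > 0, φ ∈ ℝ, and set ξ = r e^{iφ}. Let h : [0,T] → ℂ be continuous and satisfy the Volterra equation h(t) = (1/Γ(α)) ∫₀ᵗ (t−s)^{α−1} F(ξ, h(s)) ds for all t ∈ [0,T]. Define h₁ : [0, T r^{1/α}] → ℂ by h₁(t₁) = r^{−1} h(t₁ r^{−1/α}). Then h₁ satisfies h₁(t₁) = (1/Γ(α)) ∫₀^{t₁} (t₁−s₁)^{α−1} F₁(r, φ, h₁(s₁)) ds₁ for all t₁ ∈ [0, T r^{1/α}], where F₁(r, φ, w) = −(1/2)(e^{2iφ} + i e^{iφ} r^{−1}) + γ(i e^{iφ} ρν − r^{−1}) w + ((γν)²/2) w². -/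
open MeasureTheory Real

/-- The rescaled right-hand side `F₁(r,φ,w)` appearing after the change of variables
`t = t₁ r^{-1/α}`, `h = r h₁`. -/
noncomputable def riccatiF₁ (γ ν ρ r φ : ℝ) (w : ℂ) : ℂ :=
  -(1 / 2 : ℂ) * (Complex.exp (2 * Complex.I * φ) + Complex.I * Complex.exp (Complex.I * φ) * (r : ℂ)⁻¹) +
    (γ : ℂ) * (Complex.I * Complex.exp (Complex.I * φ) * ρ * ν - (r : ℂ)⁻¹) * w +
    ((γ : ℂ) * ν) ^ 2 / 2 * w ^ 2

/-- Scaling of the Riccati right-hand side under `h = r w`. -/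
theorem riccatiF_eq_sq_mul_riccatiF₁ (γ ν ρ r φ : ℝ) (hr : r ≠ 0) (z : ℂ) :
    riccatiF γ ν ρ ((r : ℂ) * Complex.exp (Complex.I * φ)) z =
      (r : ℂ) ^ 2 * riccatiF₁ γ ν ρ r φ ((r : ℂ)⁻¹ * z) := by
  have hr' : (r : ℂ) ≠ 0 := by exact_mod_cast hr
  have he : Complex.exp (2 * Complex.I * φ) = Complex.exp (Complex.I * φ) ^ 2 := by
    rw [← Complex.exp_nat_mul]
    congr 1
    push_cast
    ring
  unfold riccatiF riccatiF₁
  rw [he]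
  field_simp

/-- Scaling of the (unnormalized) Riemann–Liouville integral under a positive dilation. -/
theorem integral_rpow_sub_mul_comp_dilation (α c t : ℝ) (hc : 0 < c) (ht : 0 ≤ t)
    (g : ℝ → ℂ) :
    ∫ s in (0 : ℝ)..t * c, (((t * c - s) ^ (α - 1) : ℝ) : ℂ) * g s =
      ((c ^ α : ℝ) : ℂ) * ∫ s in (0 : ℝ)..t, (((t - s) ^ (α - 1) : ℝ) : ℂ) * g (s * c) := by
  have hsub := intervalIntegral.smul_integral_comp_mul_right (a := 0) (b := t)
    (fun s => (((t * c - s) ^ (α - 1) : ℝ) : ℂ) * g s) c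
  rw [zero_mul] at hsub
  rw [← hsub, Complex.real_smul, ← intervalIntegral.integral_const_mul,
    ← intervalIntegral.integral_const_mul]
  refine intervalIntegral.integral_congr fun s hs => ?_
  rw [Set.uIcc_of_le ht] at hs
  have hpow : c * (t * c - s * c) ^ (α - 1) = c ^ α * (t - s) ^ (α - 1) := by
    rw [← sub_mul, Real.mul_rpow (sub_nonneg.2 hs.2) hc.le, Real.rpow_sub_one hc.ne']
    field_simp
  have hpow' := congrArg (fun x : ℝ => (x : ℂ)) hpow
  push_cast at hpow'
  simp only [← mul_assoc]
  rw [hpow']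

theorem stmt16 (α γ θ ν ρ T r φ : ℝ) (hα : α ∈ Set.Ioo (0 : ℝ) 1) (hγ : 0 < γ)
    (hθ : 0 < θ) (hν : 0 < ν) (hρ : ρ ∈ Set.Ioo (-1 : ℝ) 1) (hT : 0 < T) (hr : 0 < r)
    (h : ℝ → ℂ) (hcont : ContinuousOn h (Set.Icc 0 T))
    (hVolterra : ∀ t ∈ Set.Icc (0 : ℝ) T,
      h t = ((1 / Real.Gamma α : ℝ) : ℂ) *
        ∫ s in (0 : ℝ)..t, (((t - s) ^ (α - 1) : ℝ) : ℂ) *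
          riccatiF γ ν ρ ((r : ℂ) * Complex.exp (Complex.I * φ)) (h s)) :
    ∀ t₁ ∈ Set.Icc (0 : ℝ) (T * r ^ (1 / α)),
      (r : ℂ)⁻¹ * h (t₁ * r ^ (-(1 / α))) =
        ((1 / Real.Gamma α : ℝ) : ℂ) *
          ∫ s₁ in (0 : ℝ)..t₁, (((t₁ - s₁) ^ (α - 1) : ℝ) : ℂ) *
            riccatiF₁ γ ν ρ r φ ((r : ℂ)⁻¹ * h (s₁ * r ^ (-(1 / α)))) := by
  intro t₁ ht₁
  have hc : 0 < r ^ (-(1 / α)) := Real.rpow_pos_of_pos hr _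
  have hcα : (r ^ (-(1 / α))) ^ α = r⁻¹ := by
    rw [← Real.rpow_mul hr.le, neg_mul, one_div_mul_cancel hα.1.ne', Real.rpow_neg_one]
  have hmem : t₁ * r ^ (-(1 / α)) ∈ Set.Icc 0 T := by
    refine ⟨mul_nonneg ht₁.1 hc.le, ?_⟩
    calc t₁ * r ^ (-(1 / α)) ≤ T * r ^ (1 / α) * r ^ (-(1 / α)) :=
          mul_le_mul_of_nonneg_right ht₁.2 hc.le
      _ = T := by rw [mul_assoc, ← Real.rpow_add hr, add_neg_cancel, Real.rpow_zero, mul_one]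
  have hr' : (r : ℂ) ≠ 0 := by exact_mod_cast hr.ne'
  rw [hVolterra _ hmem, integral_rpow_sub_mul_comp_dilation α _ t₁ hc ht₁.1, hcα]
  simp only [riccatiF_eq_sq_mul_riccatiF₁ γ ν ρ r φ hr.ne', mul_left_comm _ ((r : ℂ) ^ 2),
    intervalIntegral.integral_const_mul]
  push_cast
  generalize (∫ s₁ in (0 : ℝ)..t₁, (((t₁ - s₁) ^ (α - 1) : ℝ) : ℂ) *
    riccatiF₁ γ ν ρ r φ ((r : ℂ)⁻¹ * h (s₁ * r ^ (-(1 / α))))) = J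
  field_simp
end

section
/- Let γ, ν > 0, ρ ∈ (−1,1), and fix ω ∈ (−π/2, π/2). Define, for y > 0, h^∞(y e^{iω}) = (γν)^{−2} [ −γ(iρν y e^{iω} − 1) − ( (y²e^{2iω} + i y e^{iω})(γν)² + γ²(iρν y e^{iω} − 1)² )^{1/2} ], where (·)^{1/2} is the principal branch of the complex square root. Then there exist constants C > 0 and R > 0 such that for all y ≥ R, | h^∞(y e^{iω}) + y e^{iω} (iρ + √(1−ρ²)) / (γν) | ≤ C; that is, h^∞(ξ) = −ξ (iρ + √(1−ρ²))/(γν) + O(1) as ξ → ∞ along the ray arg ξ = ω. -/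
open Complex Real

/-- The stationary root `h^∞(ξ)` of the rough Heston Riccati right-hand side, with the
principal branch of the complex square root (`cpow 1/2`). -/
noncomputable def hInf (γ ν ρ : ℝ) (ξ : ℂ) : ℂ :=
  (((γ : ℂ) * ν) ^ 2)⁻¹ *
    (-(γ : ℂ) * (Complex.I * ρ * ν * ξ - 1) -
      ((ξ ^ 2 + Complex.I * ξ) * ((γ : ℂ) * ν) ^ 2 +
        (γ : ℂ) ^ 2 * (Complex.I * ρ * ν * ξ - 1) ^ 2) ^ ((1 : ℂ) / 2))

theorem cpow_half_sq (z : ℂ) : (z ^ ((1 : ℂ) / 2)) ^ 2 = z := by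
  simp

theorem cpow_half_re_nonneg (z : ℂ) : 0 ≤ (z ^ ((1 : ℂ) / 2)).re := by
  rcases eq_or_ne z 0 with rfl | hz
  · simp
  · rw [Complex.cpow_def_of_ne_zero hz, Complex.exp_re]
    have him : (Complex.log z * ((1 : ℂ) / 2)).im = z.arg / 2 := by
      rw [show (1 : ℂ) / 2 = ((1 / 2 : ℝ) : ℂ) by norm_num, Complex.im_mul_ofReal, Complex.log_im]
      ring
    rw [him]
    refine mul_nonneg (Real.exp_pos _).le (Real.cos_nonneg_of_neg_pi_div_two_le_of_le ?_ ?_)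
    · linarith [Complex.neg_pi_lt_arg z]
    · linarith [Complex.arg_le_pi z]

/-- The principal square root of `w ^ 2 + d` is close to `w` when `w` is far to the right of the
imaginary axis. -/
theorem norm_cpow_half_sub_mul_re_le (w d : ℂ) :
    ‖(w ^ 2 + d) ^ ((1 : ℂ) / 2) - w‖ * w.re ≤ ‖d‖ := by
  set S := (w ^ 2 + d) ^ ((1 : ℂ) / 2) with hS
  have hprod : (S - w) * (S + w) = d := by
    linear_combination cpow_half_sq (w ^ 2 + d)
  have hre : w.re ≤ ‖S + w‖ := by
    refine le_trans ?_ (Complex.re_le_norm (S + w))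
    rw [Complex.add_re]
    linarith [cpow_half_re_nonneg (w ^ 2 + d)]
  calc ‖S - w‖ * w.re ≤ ‖S - w‖ * ‖S + w‖ := by gcongr
    _ = ‖d‖ := by rw [← norm_mul, hprod]

theorem stmt18 (γ ν ρ ω : ℝ) (hγ : 0 < γ) (hν : 0 < ν) (hρ : ρ ∈ Set.Ioo (-1 : ℝ) 1)
    (hω : ω ∈ Set.Ioo (-(Real.pi / 2)) (Real.pi / 2)) :
    ∃ C > (0 : ℝ), ∃ R > (0 : ℝ), ∀ y : ℝ, R ≤ y →
      ‖hInf γ ν ρ ((y : ℂ) * Complex.exp (Complex.I * ω)) +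
          (y : ℂ) * Complex.exp (Complex.I * ω) *
            (Complex.I * ρ + (Real.sqrt (1 - ρ ^ 2) : ℂ)) / ((γ : ℂ) * ν)‖ ≤ C := by
  have hs : 0 < 1 - ρ ^ 2 := by nlinarith [hρ.1, hρ.2]
  have hcos : 0 < Real.cos ω := Real.cos_pos_of_mem_Ioo hω
  set s := Real.sqrt (1 - ρ ^ 2) with hs_def
  have hs_pos : 0 < s := Real.sqrt_pos.mpr hs
  have hs_sq : (s : ℂ) ^ 2 = 1 - (ρ : ℂ) ^ 2 := by
    have := Real.sq_sqrt hs.le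
    exact_mod_cast this
  have hγ' : (γ : ℂ) ≠ 0 := by exact_mod_cast hγ.ne'
  have hν' : (ν : ℂ) ≠ 0 := by exact_mod_cast hν.ne'
  set a : ℝ := γ * ν * s with ha
  have ha_pos : 0 < a := by positivity
  set b : ℂ := Complex.I * ((γ : ℂ) * ν) ^ 2 - 2 * Complex.I * ρ * (γ : ℂ) ^ 2 * ν with hb
  set K : ℝ := (‖b‖ + γ ^ 2) / (a * Real.cos ω) with hK
  have hK_nonneg : 0 ≤ K := by positivity
  refine ⟨((γ * ν) ^ 2)⁻¹ * (γ + K), by positivity, 1, one_pos, fun y hy => ?_⟩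
  have hy_pos : 0 < y := one_pos.trans_le hy
  set ξ : ℂ := (y : ℂ) * Complex.exp (Complex.I * ω) with hξ
  have hξ_norm : ‖ξ‖ = y := by
    rw [hξ, norm_mul, mul_comm Complex.I, Complex.norm_exp_ofReal_mul_I, Complex.norm_real,
      Real.norm_of_nonneg hy_pos.le, mul_one]
  have hξ_re : ((a : ℂ) * ξ).re = a * (y * Real.cos ω) := by
    rw [Complex.re_ofReal_mul, hξ, Complex.re_ofReal_mul, mul_comm Complex.I,
      Complex.exp_ofReal_mul_I_re]
  have hrad : (ξ ^ 2 + Complex.I * ξ) * ((γ : ℂ) * ν) ^ 2 +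
      (γ : ℂ) ^ 2 * (Complex.I * ρ * ν * ξ - 1) ^ 2 =
      ((a : ℂ) * ξ) ^ 2 + (b * ξ + (γ : ℂ) ^ 2) := by
    rw [ha, hb]
    push_cast
    linear_combination (γ : ℂ) ^ 2 * ν ^ 2 * ξ ^ 2 * (ρ ^ 2 * Complex.I_sq - hs_sq)
  have hroot := norm_cpow_half_sub_mul_re_le ((a : ℂ) * ξ) (b * ξ + (γ : ℂ) ^ 2)
  rw [hInf, hrad]
  set S := (((a : ℂ) * ξ) ^ 2 + (b * ξ + (γ : ℂ) ^ 2)) ^ ((1 : ℂ) / 2)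
  have hd : ‖b * ξ + (γ : ℂ) ^ 2‖ ≤ (‖b‖ + γ ^ 2) * y := by
    calc ‖b * ξ + (γ : ℂ) ^ 2‖ ≤ ‖b * ξ‖ + ‖(γ : ℂ) ^ 2‖ := norm_add_le _ _
      _ = ‖b‖ * y + γ ^ 2 := by
        rw [norm_mul, hξ_norm, norm_pow, Complex.norm_real, Real.norm_of_nonneg hγ.le]
      _ ≤ (‖b‖ + γ ^ 2) * y := by nlinarith [sq_nonneg γ]
  have hSK : ‖S - a * ξ‖ ≤ K := by
    rw [hK, le_div_iff₀ (by positivity)]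
    refine le_of_mul_le_mul_right ?_ hy_pos
    rw [hξ_re] at hroot
    linarith
  have hsum : (((γ : ℂ) * ν) ^ 2)⁻¹ * (-(γ : ℂ) * (Complex.I * ρ * ν * ξ - 1) - S) +
      ξ * (Complex.I * ρ + (s : ℂ)) / ((γ : ℂ) * ν) =
      (((γ * ν) ^ 2 : ℝ) : ℂ)⁻¹ * ((γ : ℂ) - (S - a * ξ)) := by
    rw [ha]
    push_cast
    field_simp
    ring
  rw [hsum, norm_mul, norm_inv, Complex.norm_real, Real.norm_of_nonneg (by positivity)]
  gcongr
  calc ‖(γ : ℂ) - (S - a * ξ)‖ ≤ ‖(γ : ℂ)‖ + ‖S - a * ξ‖ := norm_sub_le _ _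
    _ ≤ γ + K := by
      rw [Complex.norm_real, Real.norm_of_nonneg hγ.le]
      gcongr
end

section
/- Let X be a real-valued random variable on a probability space with E[e^{X/2}] < ∞, and let S₀, K > 0. For y ∈ ℝ set Φ(y − i/2) = E[e^{i(y − i/2)X}] = E[e^{iyX + X/2}]. Then E[ min(S₀e^X, K) ] = ( (K·S₀)^{1/2} / π ) · Re ∫₀^∞ e^{iy ln(S₀/K)} Φ(y − i/2) / (y² + 1/4) dy, where the integral converges absolutely. -/
open MeasureTheory Real

open scoped FourierTransform in
/-- The Fourier transform of the two-sided exponential `x ↦ exp (-|x| / 2)`. -/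
lemma fourier_exp_neg_abs_div_two (w : ℝ) :
    𝓕 (fun x : ℝ => Complex.exp ((-|x| / 2 : ℝ) : ℂ)) w =
      (((2 * π * w) ^ 2 + 1 / 4 : ℝ) : ℂ)⁻¹ := by
  have e1 : Set.EqOn (fun v : ℝ => Complex.exp (↑(-2 * π * v * w) * Complex.I) •
      Complex.exp ((-|v| / 2 : ℝ) : ℂ))
      (fun v : ℝ => Complex.exp ((1 / 2 - 2 * π * w * Complex.I) * v)) (Set.Iic 0) := by
    intro v hv
    simp only [smul_eq_mul, ← Complex.exp_add, abs_of_nonpos (Set.mem_Iic.mp hv)]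
    congr 1; push_cast; ring
  have e2 : Set.EqOn (fun v : ℝ => Complex.exp (↑(-2 * π * v * w) * Complex.I) •
      Complex.exp ((-|v| / 2 : ℝ) : ℂ))
      (fun v : ℝ => Complex.exp ((-1 / 2 - 2 * π * w * Complex.I) * v)) (Set.Ioi 0) := by
    intro v hv
    simp only [smul_eq_mul, ← Complex.exp_add, abs_of_pos (Set.mem_Ioi.mp hv)]
    congr 1; push_cast; ring
  have r1 : 0 < (1 / 2 - 2 * π * w * Complex.I : ℂ).re := by simp
  have r2 : (-1 / 2 - 2 * π * w * Complex.I : ℂ).re < 0 := by simp; norm_num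
  have n1 : (1 / 2 - 2 * π * w * Complex.I : ℂ) ≠ 0 := fun h => by
    rw [h] at r1; exact lt_irrefl _ r1
  have n2 : (-1 / 2 - 2 * π * w * Complex.I : ℂ) ≠ 0 := fun h => by
    rw [h] at r2; exact lt_irrefl _ r2
  have n3 : (((2 * π * w) ^ 2 + 1 / 4 : ℝ) : ℂ) ≠ 0 := by
    exact_mod_cast (by positivity : ((2 * π * w) ^ 2 + 1 / 4 : ℝ) ≠ 0)
  rw [Real.fourier_real_eq_integral_exp_smul, ← intervalIntegral.integral_Iic_add_Ioi
    ((integrableOn_congr_fun e1 measurableSet_Iic).mpr (integrableOn_exp_mul_complex_Iic r1 0))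
    ((integrableOn_congr_fun e2 measurableSet_Ioi).mpr (integrableOn_exp_mul_complex_Ioi r2 0)),
    setIntegral_congr_fun measurableSet_Iic e1, setIntegral_congr_fun measurableSet_Ioi e2,
    integral_exp_mul_complex_Iic r1, integral_exp_mul_complex_Ioi r2]
  simp only [Complex.ofReal_zero, mul_zero, Complex.exp_zero]
  rw [div_add_div _ _ n1 n2, ← one_div, div_eq_div_iff (mul_ne_zero n1 n2) n3]
  push_cast
  linear_combination (-(2 * π * w) ^ 2 : ℂ) * Complex.I_sq

lemma integrable_inv_sq_add_quarter : Integrable fun y : ℝ => (y ^ 2 + 1 / 4)⁻¹ := by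
  have h := (integrable_inv_one_add_sq.comp_mul_left' (two_ne_zero' ℝ)).const_mul 4
  refine h.congr (.of_forall fun y => ?_)
  have : y ^ 2 + 1 / 4 ≠ 0 := by positivity
  have : 1 + (2 * y) ^ 2 ≠ 0 := by positivity
  simp only
  field_simp
  ring

open scoped FourierTransform in
lemma integral_exp_mul_I_div_sq_add_quarter (t : ℝ) :
    ∫ y : ℝ, Complex.exp (Complex.I * y * t) / ((y : ℂ) ^ 2 + 1 / 4) =
      ((2 * π * Real.exp (-|t| / 2) : ℝ) : ℂ) := by
  have hpi : (2 * π : ℝ) ≠ 0 := by positivity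
  have hF : 𝓕 (fun x : ℝ => Complex.exp ((-|x| / 2 : ℝ) : ℂ)) =
      fun w : ℝ => (((2 * π * w) ^ 2 + 1 / 4 : ℝ) : ℂ)⁻¹ :=
    funext fourier_exp_neg_abs_div_two
  have hint : Integrable (fun x : ℝ => Complex.exp ((-|x| / 2 : ℝ) : ℂ)) := by
    have h : Integrable fun x : ℝ => Real.exp (-|x| / 2) := by
      rw [← integrableOn_univ, ← Set.Iic_union_Ioi (a := (0 : ℝ))]
      refine .union ?_ ?_
      · refine (integrableOn_exp_mul_Iic (a := 1 / 2) (by norm_num) 0).congr_fun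
          (fun x hx => ?_) measurableSet_Iic
        simp only [abs_of_nonpos (Set.mem_Iic.mp hx)]
        ring_nf
      · refine (integrableOn_exp_mul_Ioi (a := -1 / 2) (by norm_num) 0).congr_fun
          (fun x hx => ?_) measurableSet_Ioi
        simp only [abs_of_pos (Set.mem_Ioi.mp hx)]
        ring_nf
    simpa using h.ofReal (𝕜 := ℂ)
  have hFint : Integrable (𝓕 (fun x : ℝ => Complex.exp ((-|x| / 2 : ℝ) : ℂ))) := by
    rw [hF]
    simpa using (integrable_inv_sq_add_quarter.comp_mul_left' hpi).ofReal (𝕜 := ℂ)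
  have h := congrFun (Continuous.fourierInv_fourier_eq (by fun_prop) hint hFint) t
  rw [hF, Real.fourierInv_eq'] at h
  have hc := Measure.integral_comp_mul_left
    (fun y : ℝ => Complex.exp (Complex.I * y * t) / ((y : ℂ) ^ 2 + 1 / 4)) (2 * π)
  have hl : ∫ x : ℝ, Complex.exp (Complex.I * ((2 * π * x : ℝ) : ℂ) * t) /
      ((((2 * π * x : ℝ) : ℂ)) ^ 2 + 1 / 4) = Complex.exp ((-|t| / 2 : ℝ) : ℂ) := by
    rw [← h]
    congr 1 with x
    rw [smul_eq_mul, div_eq_mul_inv]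
    congr 2
    · simp; ring
    · push_cast; rfl
  rw [hl, abs_of_pos (inv_pos.mpr Real.two_pi_pos), Complex.real_smul] at hc
  rw [Complex.ofReal_mul, Complex.ofReal_exp (-|t| / 2), hc]
  rw [Complex.ofReal_inv, mul_inv_cancel_left₀ (Complex.ofReal_ne_zero.mpr hpi)]

lemma norm_exp_mul_I_div_sq_add_quarter (t y : ℝ) :
    ‖Complex.exp (Complex.I * y * t) / ((y : ℂ) ^ 2 + 1 / 4)‖ = (y ^ 2 + 1 / 4)⁻¹ := by
  have h1 : Complex.I * y * t = ((y * t : ℝ) : ℂ) * Complex.I := by push_cast; ring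
  have h2 : (y : ℂ) ^ 2 + 1 / 4 = ((y ^ 2 + 1 / 4 : ℝ) : ℂ) := by push_cast; ring
  rw [norm_div, h1, Complex.norm_exp_ofReal_mul_I, h2, Complex.norm_real, Real.norm_eq_abs,
    abs_of_pos (by positivity), one_div]

lemma continuous_exp_mul_I_div_sq_add_quarter :
    Continuous fun p : ℝ × ℝ =>
      Complex.exp (Complex.I * p.1 * p.2) / ((p.1 : ℂ) ^ 2 + 1 / 4) := by
  refine Continuous.div (by fun_prop) (by fun_prop) fun p => ?_
  have h : ((p.1 ^ 2 + 1 / 4 : ℝ) : ℂ) ≠ 0 := Complex.ofReal_ne_zero.mpr (by positivity)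
  push_cast at h
  exact h

lemma integrable_exp_mul_I_div_sq_add_quarter (t : ℝ) :
    Integrable fun y : ℝ => Complex.exp (Complex.I * y * t) / ((y : ℂ) ^ 2 + 1 / 4) :=
  integrable_inv_sq_add_quarter.mono'
    (continuous_exp_mul_I_div_sq_add_quarter.comp
      (by fun_prop : Continuous fun y : ℝ => (y, t))).aestronglyMeasurable
    (.of_forall fun y => (norm_exp_mul_I_div_sq_add_quarter t y).le)

lemma re_integral_Ioi_exp_mul_I_div_sq_add_quarter (t : ℝ) :
    (∫ y in Set.Ioi (0 : ℝ), Complex.exp (Complex.I * y * t) / ((y : ℂ) ^ 2 + 1 / 4)).re =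
      π * Real.exp (-|t| / 2) := by
  have hre (y : ℝ) : (Complex.exp (Complex.I * y * t) / ((y : ℂ) ^ 2 + 1 / 4)).re =
      Real.cos (y * t) / (y ^ 2 + 1 / 4) := by
    have h1 : Complex.I * y * t = ((y * t : ℝ) : ℂ) * Complex.I := by push_cast; ring
    have h2 : (y : ℂ) ^ 2 + 1 / 4 = ((y ^ 2 + 1 / 4 : ℝ) : ℂ) := by push_cast; ring
    rw [h1, h2, Complex.div_ofReal_re, Complex.exp_ofReal_mul_I_re]
  have hint := integrable_exp_mul_I_div_sq_add_quarter t
  have h := congrArg Complex.re (integral_exp_mul_I_div_sq_add_quarter t)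
  rw [← RCLike.re_to_complex, ← integral_re hint,
    Complex.ofReal_re] at h
  rw [← RCLike.re_to_complex, ← integral_re hint.integrableOn]
  simp only [RCLike.re_to_complex, hre] at h ⊢
  have habs := integral_comp_abs (f := fun y : ℝ => Real.cos (y * t) / (y ^ 2 + 1 / 4))
  have heven (y : ℝ) : Real.cos (|y| * t) / (|y| ^ 2 + 1 / 4) =
      Real.cos (y * t) / (y ^ 2 + 1 / 4) := by
    rcases abs_choice y with h | h <;> simp [h]
  simp only [heven] at habs
  linarith

/-- The covered call payoff in terms of the two-sided exponential of the log-moneyness. -/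
lemma min_mul_exp_eq_sqrt_mul {S₀ K : ℝ} (hS : 0 < S₀) (hK : 0 < K) (x : ℝ) :
    min (S₀ * Real.exp x) K =
      √(K * S₀) * (Real.exp (x / 2) * Real.exp (-|Real.log (S₀ / K) + x| / 2)) := by
  have hsq : √(K * S₀) = Real.exp ((Real.log K + Real.log S₀) / 2) := by
    rw [← Real.log_mul hK.ne' hS.ne', Real.exp_half, Real.exp_log (by positivity)]
  rw [hsq, Real.log_div hS.ne' hK.ne', ← Real.exp_add, ← Real.exp_add]
  nth_rw 1 [← Real.exp_log hS]
  nth_rw 1 [← Real.exp_log hK]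
  rw [← Real.exp_add, ← Real.exp_monotone.map_min]
  congr 1
  rcases le_total 0 (Real.log S₀ - Real.log K + x) with h | h
  · rw [abs_of_nonneg h, min_eq_right (by linarith)]; ring
  · rw [abs_of_nonpos h, min_eq_left (by linarith)]; ring

theorem stmt19 {Ω : Type*} [MeasurableSpace Ω] (μ : Measure Ω) [IsProbabilityMeasure μ]
    (X : Ω → ℝ) (hX : Measurable X) (S₀ K : ℝ) (hS : 0 < S₀) (hK : 0 < K)
    (hmom : Integrable (fun a => Real.exp (X a / 2)) μ) :
    IntegrableOn (fun y : ℝ =>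
      Complex.exp (Complex.I * y * Real.log (S₀ / K)) *
        (∫ a, Complex.exp (Complex.I * ((y : ℂ) - Complex.I / 2) * X a) ∂μ) /
        ((y : ℂ) ^ 2 + 1 / 4)) (Set.Ioi 0) ∧
    (∫ a, min (S₀ * Real.exp (X a)) K ∂μ) =
      (Real.sqrt (K * S₀) / Real.pi) *
        (∫ y in Set.Ioi (0 : ℝ),
          Complex.exp (Complex.I * y * Real.log (S₀ / K)) *
            (∫ a, Complex.exp (Complex.I * ((y : ℂ) - Complex.I / 2) * X a) ∂μ) /
            ((y : ℂ) ^ 2 + 1 / 4)).re := by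
  set L := Real.log (S₀ / K) with hL
  let G : ℝ → Ω → ℂ := fun y a =>
    Real.exp (X a / 2) *
      (Complex.exp (Complex.I * y * (L + X a : ℝ)) / ((y : ℂ) ^ 2 + 1 / 4))
  have hG (y : ℝ) : Complex.exp (Complex.I * y * L) *
        (∫ a, Complex.exp (Complex.I * ((y : ℂ) - Complex.I / 2) * X a) ∂μ) /
        ((y : ℂ) ^ 2 + 1 / 4) = ∫ a, G y a ∂μ := by
    rw [← integral_const_mul, ← integral_div]
    congr 1 with a
    simp only [G]
    rw [← mul_div_assoc, Complex.ofReal_exp, ← Complex.exp_add, ← Complex.exp_add]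
    congr 2
    push_cast
    linear_combination (-(X a : ℂ) / 2) * Complex.I_sq
  have hprod : Integrable (Function.uncurry G) ((volume.restrict (Set.Ioi 0)).prod μ) := by
    refine (integrable_inv_sq_add_quarter.integrableOn.mul_prod hmom).mono' ?_
      (.of_forall fun p => ?_)
    · have h1 : Measurable fun p : ℝ × Ω => (p.1, L + X p.2) := by fun_prop
      have h2 : Measurable fun p : ℝ × Ω => (Real.exp (X p.2 / 2) : ℂ) := by fun_prop
      exact (h2.mul (continuous_exp_mul_I_div_sq_add_quarter.measurable.comp h1)).aestronglyMeasurable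
    · simp only [Function.uncurry, G]
      rw [norm_mul, norm_exp_mul_I_div_sq_add_quarter, Complex.norm_real, Real.norm_eq_abs,
        Real.abs_exp, mul_comm]
  simp only [hG]
  refine ⟨hprod.integral_prod_left, ?_⟩
  have hright : Integrable (fun a => ∫ y in Set.Ioi (0 : ℝ), G y a) μ := hprod.integral_prod_right
  rw [integral_integral_swap hprod, ← RCLike.re_to_complex, ← integral_re hright,
    ← integral_const_mul]
  congr 1 with a
  simp only [G]
  rw [integral_const_mul, RCLike.re_to_complex, Complex.re_ofReal_mul,
    re_integral_Ioi_exp_mul_I_div_sq_add_quarter, min_mul_exp_eq_sqrt_mul hS hK, ← hL]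
  field_simp
end
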